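/- Let x ∈ Γ be a C^{1,1}-point: there are a bounded open U ∋ x and u > 0 such that the two-sided ball condition with radius u holds at every point of Γ ∩ U and every point of Γ_u ∩ U has its nearest boundary point in Γ ∩ U. Let δ ≥ 0 with δ ≠ 1. Then for every r with 0 < r < u/2 and 2(d−1)(r/u) < |δ−1| one has ‖d_Γ^{δ/2−1}ψ‖_2 ≤ a‖d_Γ^{δ/2}|∇ψ|‖_2 for all ψ ∈ C_c^1(Γ_r ∩ U), with a = 2/(|δ−1| − 2(d−1)(r/u)); moreover the local Hardy constant satisfies a_δ(x) = inf{a_δ(Γ∩V) : V ⊆ ℝ^d bounded open, x ∈ V} = 2/|δ−1|. -/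

import Mathlib

open MeasureTheory Metric Set ENNReal RealInnerProductSpace

noncomputable section

/-- The Euclidean distance from `x` to the boundary `Γ = ∂Ω` of `Ω`. -/
def distB {d : ℕ} (Ω : Set (EuclideanSpace ℝ (Fin d))) (x : EuclideanSpace ℝ (Fin d)) : ℝ :=
  Metric.infDist x (frontier Ω)

/-- The boundary layer `Γ_r = {x ∈ Ω : d_Γ(x) < r}`. -/
def bdryLayer {d : ℕ} (Ω : Set (EuclideanSpace ℝ (Fin d))) (r : ℝ) :
    Set (EuclideanSpace ℝ (Fin d)) :=
  {x | x ∈ Ω ∧ distB Ω x < r}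

/-- `C_c^1` real functions with compact support contained in `U`. -/
def IsCc1 {d : ℕ} (U : Set (EuclideanSpace ℝ (Fin d)))
    (ψ : EuclideanSpace ℝ (Fin d) → ℝ) : Prop :=
  ContDiff ℝ 1 ψ ∧ HasCompactSupport ψ ∧ tsupport ψ ⊆ U

/-- The `L²` norm with respect to Lebesgue measure. -/
def L2N {d : ℕ} (f : EuclideanSpace ℝ (Fin d) → ℝ) : ℝ≥0∞ :=
  eLpNorm f 2 volume

/-- The weighted norm `‖d_Γ^p ψ‖₂`. -/
def wNorm {d : ℕ} (Ω : Set (EuclideanSpace ℝ (Fin d))) (p : ℝ)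
    (ψ : EuclideanSpace ℝ (Fin d) → ℝ) : ℝ≥0∞ :=
  L2N (fun x => distB Ω x ^ p * ψ x)

/-- The weighted gradient norm `‖d_Γ^p |∇ψ|‖₂`. -/
def wGradNorm {d : ℕ} (Ω : Set (EuclideanSpace ℝ (Fin d))) (p : ℝ)
    (ψ : EuclideanSpace ℝ (Fin d) → ℝ) : ℝ≥0∞ :=
  L2N (fun x => distB Ω x ^ p * ‖fderiv ℝ ψ x‖)

/-- The (boundary) Hardy inequality `‖d_Γ^{δ/2-1}ψ‖₂ ≤ a ‖d_Γ^{δ/2}|∇ψ|‖₂`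
with constant `a` for all test functions `ψ ∈ C_c^1(S)`. -/
def BHardy {d : ℕ} (Ω : Set (EuclideanSpace ℝ (Fin d))) (δ : ℝ)
    (S : Set (EuclideanSpace ℝ (Fin d))) (a : ℝ) : Prop :=
  ∀ ψ, IsCc1 S ψ → wNorm Ω (δ/2 - 1) ψ ≤ ENNReal.ofReal a * wGradNorm Ω (δ/2) ψ

/-- The weak Hardy inequality `‖d_Γ^{δ/2-1}ψ‖₂ ≤ b ‖d_Γ^{δ/2}|∇ψ|‖₂ + c ‖ψ‖₂`
with constants `b, c` for all test functions `ψ ∈ C_c^1(S)`. -/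
def WHardy {d : ℕ} (Ω : Set (EuclideanSpace ℝ (Fin d))) (δ : ℝ)
    (S : Set (EuclideanSpace ℝ (Fin d))) (b c : ℝ) : Prop :=
  ∀ ψ, IsCc1 S ψ →
    wNorm Ω (δ/2 - 1) ψ ≤ ENNReal.ofReal b * wGradNorm Ω (δ/2) ψ + ENNReal.ofReal c * L2N ψ

/-- The optimal Hardy constant for test functions supported in `S`
(the infimum of the `a > 0` for which the Hardy inequality holds on `S`;
`∞` if there is no such constant). -/
def hardyConstS {d : ℕ} (Ω : Set (EuclideanSpace ℝ (Fin d))) (δ : ℝ)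
    (S : Set (EuclideanSpace ℝ (Fin d))) : ℝ≥0∞ :=
  sInf {t | ∃ a : ℝ, 0 < a ∧ t = ENNReal.ofReal a ∧ BHardy Ω δ S a}

/-- The boundary Hardy constant `a_δ(Γ) = inf_{r>0} a_δ(Γ_r)`. -/
def hardyConst {d : ℕ} (Ω : Set (EuclideanSpace ℝ (Fin d))) (δ : ℝ) : ℝ≥0∞ :=
  ⨅ (r : ℝ) (_ : 0 < r), hardyConstS Ω δ (bdryLayer Ω r)

/-- The local boundary Hardy constant `a_δ(Γ ∩ U) = inf_{r>0} a_δ(Γ_r ∩ U)`. -/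
def hardyConstOn {d : ℕ} (Ω : Set (EuclideanSpace ℝ (Fin d))) (δ : ℝ)
    (U : Set (EuclideanSpace ℝ (Fin d))) : ℝ≥0∞ :=
  ⨅ (r : ℝ) (_ : 0 < r), hardyConstS Ω δ (bdryLayer Ω r ∩ U)

/-- The weak Hardy constant `b_δ(Ω)`: the infimum of the `b > 0` for which there
is a `c > 0` such that the weak Hardy inequality holds on `Ω`. -/
def weakConstDomain {d : ℕ} (Ω : Set (EuclideanSpace ℝ (Fin d))) (δ : ℝ) : ℝ≥0∞ :=
  sInf {t | ∃ b c : ℝ, 0 < b ∧ 0 < c ∧ t = ENNReal.ofReal b ∧ WHardy Ω δ Ω b c}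

/-- The weak Hardy constant `b_δ(Γ)`: the infimum of the `b > 0` for which there
are `r > 0` and `c > 0` such that the weak Hardy inequality holds on `Γ_r`. -/
def weakConstBdry {d : ℕ} (Ω : Set (EuclideanSpace ℝ (Fin d))) (δ : ℝ) : ℝ≥0∞ :=
  sInf {t | ∃ b c r : ℝ, 0 < b ∧ 0 < c ∧ 0 < r ∧ t = ENNReal.ofReal b ∧
    WHardy Ω δ (bdryLayer Ω r) b c}

/-- The weak Hardy constant `b_δ(Γ ∩ U)`. -/
def weakConstOn {d : ℕ} (Ω : Set (EuclideanSpace ℝ (Fin d))) (δ : ℝ)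
    (U : Set (EuclideanSpace ℝ (Fin d))) : ℝ≥0∞ :=
  sInf {t | ∃ b c r : ℝ, 0 < b ∧ 0 < c ∧ 0 < r ∧ t = ENNReal.ofReal b ∧
    WHardy Ω δ (bdryLayer Ω r ∩ U) b c}

/-- A domain: a nonempty open connected proper subset of `ℝ^d`. -/
def IsDomainSet {d : ℕ} (Ω : Set (EuclideanSpace ℝ (Fin d))) : Prop :=
  IsOpen Ω ∧ IsConnected Ω ∧ Ω ≠ Set.univ

/-- The two-sided (interior and exterior) ball condition with radius `u` at `y ∈ Γ`:
there is an interior ball `B̄(z;u) ⊆ Ω ∪ {y}` touching `Γ` exactly at `y`, and an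
exterior ball touching `Ω̄` exactly at `y`. -/
def TwoSidedBall {d : ℕ} (Ω : Set (EuclideanSpace ℝ (Fin d))) (u : ℝ)
    (y : EuclideanSpace ℝ (Fin d)) : Prop :=
  (∃ z ∈ Ω, Metric.closedBall z u ∩ Ωᶜ = {y}) ∧
  (∃ z' ∈ (closure Ω)ᶜ, Metric.closedBall z' u ∩ closure Ω = {y})

open Filter Topology

section Geometry

variable {d : ℕ} {Ω : Set (EuclideanSpace ℝ (Fin d))}

lemma TwoSidedBall.exists_normal (hΩ : IsOpen Ω) {u : ℝ} (hu : 0 < u)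
    {p : EuclideanSpace ℝ (Fin d)} (hp : p ∈ frontier Ω) (h : TwoSidedBall Ω u p) :
    ∃ ν : EuclideanSpace ℝ (Fin d), ‖ν‖ = 1 ∧ ball (p + u • ν) u ⊆ Ω ∧
      Disjoint (ball (p - u • ν) u) Ω := by
  obtain ⟨⟨z, -, hz⟩, ⟨z', hz', hz2⟩⟩ := h
  have hpΩ : p ∉ Ω := by
    rw [hΩ.frontier_eq] at hp
    exact hp.2
  have hpc : p ∈ closure Ω := frontier_subset_closure hp
  have hpz : p ∈ closedBall z u := (hz.symm ▸ mem_singleton p : p ∈ closedBall z u ∩ Ωᶜ).1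
  have hpz' : p ∈ closedBall z' u :=
    (hz2.symm ▸ mem_singleton p : p ∈ closedBall z' u ∩ closure Ω).1
  have hnz : dist p z = u := by
    refine le_antisymm hpz (le_of_not_gt fun hlt => ?_)
    have hne : z' ≠ p := fun h => hz' (h ▸ hpc)
    have hcont : ContinuousAt (fun t : ℝ => AffineMap.lineMap p z' t) 0 :=
      AffineMap.lineMap_continuous.continuousAt
    have hev : ∀ᶠ t in 𝓝[>] (0 : ℝ), AffineMap.lineMap p z' t ∈ ball z u ∧ t < 1 ∧ 0 < t := by
      have h1 : ∀ᶠ t in 𝓝 (0 : ℝ), AffineMap.lineMap p z' t ∈ ball z u :=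
        hcont.eventually (isOpen_ball.mem_nhds (by simpa using hlt))
      filter_upwards [nhdsWithin_le_nhds h1,
        nhdsWithin_le_nhds (Iio_mem_nhds (zero_lt_one' ℝ)), self_mem_nhdsWithin] with t a b c
      exact ⟨a, b, c⟩
    obtain ⟨t, h1, h2, h3⟩ := hev.exists
    have h4 : AffineMap.lineMap p z' t ∈ closedBall z' u :=
      (convex_closedBall z' u).lineMap_mem hpz' (mem_closedBall_self hu.le) ⟨h3.le, h2.le⟩
    have h5 : AffineMap.lineMap p z' t ≠ p := by
      intro h
      rw [AffineMap.lineMap_eq_left_iff] at h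
      rcases h with h | h
      · exact hne h.symm
      · exact h3.ne' h
    have h6 : AffineMap.lineMap p z' t ∉ Ω := fun h =>
      h5 (hz2.subset ⟨h4, subset_closure h⟩)
    exact h5 (hz.subset ⟨ball_subset_closedBall h1, h6⟩)
  have hin : ball z u ⊆ Ω := fun q hq => by
    by_contra hqΩ
    have : q = p := hz.subset ⟨ball_subset_closedBall hq, hqΩ⟩
    rw [this, mem_ball, hnz] at hq
    exact lt_irrefl _ hq
  have hout : Disjoint (ball z' u) Ω := Set.disjoint_left.2 fun q hq hqΩ =>
    hpΩ ((hz2.subset ⟨ball_subset_closedBall hq, subset_closure hqΩ⟩ : q = p) ▸ hqΩ)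
  have hdist : u + u ≤ dist z z' :=
    (disjoint_ball_ball_iff hu hu).1 (hout.symm.mono_left hin)
  have hsum : (z - p) + (z' - p) = 0 := by
    have h1 := parallelogram_law_with_norm ℝ (z - p) (z' - p)
    have h2 : ‖(z - p) - (z' - p)‖ = dist z z' := by rw [dist_eq_norm]; congr 1; abel
    have h3 : ‖z - p‖ = u := by rw [← dist_eq_norm, dist_comm, hnz]
    have h4 : ‖z' - p‖ ≤ u := by rw [← dist_eq_norm, dist_comm]; exact hpz'
    rw [h2, h3] at h1
    have h5 : ‖z - p + (z' - p)‖ = 0 := by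
      have := norm_nonneg (z - p + (z' - p))
      have := norm_nonneg (z' - p)
      nlinarith
    exact norm_eq_zero.1 h5
  refine ⟨u⁻¹ • (z - p), ?_, ?_, ?_⟩
  · rw [norm_smul, ← dist_eq_norm, dist_comm, hnz, Real.norm_eq_abs, abs_inv, abs_of_pos hu,
      inv_mul_cancel₀ hu.ne']
  · rw [smul_inv_smul₀ hu.ne']
    simpa using hin
  · rw [smul_inv_smul₀ hu.ne']
    have : p - (z - p) = z' := by
      rw [add_eq_zero_iff_neg_eq] at hsum
      rw [sub_eq_add_neg, hsum]; abel
    rwa [this]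

lemma distB_pos (hΩ : IsOpen Ω) (hne : (frontier Ω).Nonempty) {y : EuclideanSpace ℝ (Fin d)}
    (hy : y ∈ Ω) : 0 < distB Ω y := by
  refine (isClosed_frontier.notMem_iff_infDist_pos hne).1 fun h => ?_
  rw [hΩ.frontier_eq] at h
  exact h.2 hy

lemma ball_distB_subset (hΩ : IsOpen Ω) {y : EuclideanSpace ℝ (Fin d)} (hy : y ∈ Ω) :
    ball y (distB Ω y) ⊆ Ω := by
  rcases le_or_gt (distB Ω y) 0 with h | hpos
  · simp [ball_eq_empty.2 h]
  refine (convex_ball y (distB Ω y)).isPreconnected.subset_of_closure_inter_subset hΩ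
    ⟨y, mem_ball_self hpos, hy⟩ fun w hw => ?_
  by_contra hwΩ
  have hwf : w ∈ frontier Ω := by
    rw [hΩ.frontier_eq]
    exact ⟨hw.1, hwΩ⟩
  have h1 : distB Ω y ≤ dist y w := infDist_le_dist_of_mem hwf
  have h2 := mem_ball'.1 hw.2
  linarith

lemma sub_norm_le_distB (hne : (frontier Ω).Nonempty) (hΩ : IsOpen Ω)
    {c : EuclideanSpace ℝ (Fin d)} {u : ℝ} (h : ball c u ⊆ Ω) (y : EuclideanSpace ℝ (Fin d)) :
    u - ‖y - c‖ ≤ distB Ω y := by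
  refine (le_infDist hne).2 fun q hq => ?_
  have hqc : u ≤ dist q c := by
    by_contra hlt
    rw [hΩ.frontier_eq] at hq
    exact hq.2 (h (mem_ball.2 (not_le.1 hlt)))
  have := dist_triangle q y c
  rw [dist_comm q y] at this
  rw [← dist_eq_norm]
  linarith

lemma distB_le_norm_sub (hne : (frontier Ω).Nonempty) (hΩ : IsOpen Ω)
    {c : EuclideanSpace ℝ (Fin d)} {u : ℝ} (hu : 0 < u) (h : Disjoint (ball c u) Ω)
    {y : EuclideanSpace ℝ (Fin d)} (hy : y ∈ Ω) :
    distB Ω y ≤ ‖y - c‖ - u := by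
  have h1 := (disjoint_ball_ball_iff (distB_pos hΩ hne hy) hu).1
    (h.symm.mono_left (ball_distB_subset hΩ hy))
  rw [dist_eq_norm] at h1
  linarith

lemma eq_add_smul_normal (hΩ : IsOpen Ω) {p y ν : EuclideanSpace ℝ (Fin d)} {u : ℝ} (hu : 0 < u)
    (hp : p ∈ frontier Ω) (hν : ‖ν‖ = 1) (hout : Disjoint (ball (p - u • ν) u) Ω) (hy : y ∈ Ω)
    (hyp : dist y p = distB Ω y) : y = p + distB Ω y • ν := by
  have h1 := distB_le_norm_sub ⟨p, hp⟩ hΩ hu hout hy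
  have hs := distB_pos hΩ ⟨p, hp⟩ hy
  set s := distB Ω y
  have h2 : ‖(y - p) + u • ν‖ ^ 2 = s ^ 2 + 2 * (u * ⟪y - p, ν⟫) + u ^ 2 := by
    rw [norm_add_sq_real, inner_smul_right, norm_smul, hν, ← dist_eq_norm, hyp,
      Real.norm_eq_abs, abs_of_pos hu]
    ring
  have h3 : y - (p - u • ν) = (y - p) + u • ν := by abel
  rw [h3] at h1
  have h4 : (s + u) ^ 2 ≤ ‖(y - p) + u • ν‖ ^ 2 := by
    gcongr
    linarith
  have h5 : s ≤ ⟪y - p, ν⟫ := by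
    have : 0 ≤ u * (⟪y - p, ν⟫ - s) := by nlinarith
    have := nonneg_of_mul_nonneg_right this hu
    linarith
  have h6 : ‖(y - p) - s • ν‖ ^ 2 = s ^ 2 - 2 * (s * ⟪y - p, ν⟫) + s ^ 2 := by
    rw [norm_sub_sq_real, inner_smul_right, norm_smul, hν, ← dist_eq_norm, hyp,
      Real.norm_eq_abs, abs_of_pos hs]
    ring
  have h7 : ‖(y - p) - s • ν‖ ^ 2 = 0 :=
    le_antisymm (by nlinarith) (sq_nonneg _)
  have h8 : (y - p) - s • ν = 0 := by simpa using h7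
  rw [sub_eq_zero] at h8
  rw [← h8]; abel

lemma norm_add_norm_sub_le {E : Type*} [NormedAddCommGroup E] [InnerProductSpace ℝ E]
    {w e : E} (hw : w ≠ 0) (he : ‖e‖ = 1) (h : ℝ) :
    ‖w + h • e‖ + ‖w - h • e‖ - 2 * ‖w‖ ≤
      h ^ 2 / ‖w‖ * (1 - ⟪w, e⟫ ^ 2 / (‖w‖ ^ 2 + h ^ 2)) := by
  have hρ : 0 < ‖w‖ := norm_pos_iff.2 hw
  set ρ := ‖w‖ with hρd
  set m := ⟪w, e⟫
  have hm : m ^ 2 ≤ ρ ^ 2 := by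
    have := abs_real_inner_le_norm w e
    rw [he, mul_one] at this
    exact sq_le_sq' (by linarith [neg_abs_le m]) (by linarith [le_abs_self m])
  have hhe : ‖h • e‖ ^ 2 = h ^ 2 := by
    rw [norm_smul, he, mul_one, Real.norm_eq_abs, sq_abs]
  have ha : ‖w + h • e‖ ^ 2 = ρ ^ 2 + h ^ 2 + 2 * (h * m) := by
    rw [norm_add_sq_real, inner_smul_right, hhe]; ring
  have hb : ‖w - h • e‖ ^ 2 = ρ ^ 2 + h ^ 2 - 2 * (h * m) := by
    rw [norm_sub_sq_real, inner_smul_right, hhe]; ring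
  have ha0 := norm_nonneg (w + h • e)
  have hb0 := norm_nonneg (w - h • e)
  set a := ‖w + h • e‖
  set b := ‖w - h • e‖
  set S := ρ ^ 2 + h ^ 2 with hS
  have hSpos : 0 < S := by positivity
  have hq : 0 ≤ 1 - m ^ 2 / S := by
    rw [sub_nonneg, div_le_one hSpos]
    nlinarith [sq_nonneg h]
  have hmul : m ^ 2 / S * S = m ^ 2 := div_mul_cancel₀ _ hSpos.ne'
  set k := m ^ 2 / S with hk
  have hk0 : 0 ≤ k := by positivity
  have hab : a * b ≤ S - 2 * h ^ 2 * k := by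
    have h1 : 0 ≤ S - 2 * h ^ 2 * k ∨ S - 2 * h ^ 2 * k < 0 := le_or_gt _ _
    have h2 : (a * b) ^ 2 = S ^ 2 - 4 * h ^ 2 * m ^ 2 := by
      rw [mul_pow, ha, hb]; ring
    have h3 : (a * b) ^ 2 ≤ (S - 2 * h ^ 2 * k) ^ 2 := by
      rw [h2, ← hmul]
      nlinarith [sq_nonneg (h ^ 2 * k)]
    have h4 : 0 ≤ S - 2 * h ^ 2 * k := by
      have h5 : h ^ 2 * k * S ≤ h ^ 2 * ρ ^ 2 := by
        rw [mul_assoc, hmul]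
        exact mul_le_mul_of_nonneg_left hm (sq_nonneg h)
      have h6 : 0 ≤ (S - 2 * h ^ 2 * k) * S := by
        nlinarith [sq_nonneg (h ^ 2 - ρ ^ 2)]
      exact nonneg_of_mul_nonneg_left h6 hSpos
    exact abs_le_of_sq_le_sq' h3 h4 |>.2
  have hsum : (a + b) ^ 2 ≤ (2 * ρ + h ^ 2 / ρ * (1 - k)) ^ 2 := by
    have e1 : (2 * ρ + h ^ 2 / ρ * (1 - k)) ^ 2 =
        4 * ρ ^ 2 + 4 * h ^ 2 * (1 - k) + (h ^ 2 / ρ * (1 - k)) ^ 2 := by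
      field_simp; ring
    rw [e1]
    nlinarith [sq_nonneg (h ^ 2 / ρ * (1 - k))]
  have := abs_le_of_sq_le_sq' hsum (by positivity)
  linarith [this.2]

lemma sum_norm_add_norm_sub_le {E : Type*} [NormedAddCommGroup E] [InnerProductSpace ℝ E]
    {ι : Type*} [Fintype ι] (b : OrthonormalBasis ι ℝ E) {w : E} {ρ : ℝ} (hρ : 0 < ρ)
    (hw : ρ ≤ ‖w‖) (hc : 1 ≤ Fintype.card ι) (h : ℝ) :
    ∑ i, (‖w + h • b i‖ + ‖w - h • b i‖ - 2 * ‖w‖) ≤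
      h ^ 2 * (ρ⁻¹ * ((Fintype.card ι : ℝ) - 1 + h ^ 2 / ρ ^ 2)) := by
  have hw0 : 0 < ‖w‖ := hρ.trans_le hw
  have hc' : (1 : ℝ) ≤ Fintype.card ι := by exact_mod_cast hc
  calc ∑ i, (‖w + h • b i‖ + ‖w - h • b i‖ - 2 * ‖w‖)
      ≤ ∑ i, h ^ 2 / ‖w‖ * (1 - ⟪w, b i⟫ ^ 2 / (‖w‖ ^ 2 + h ^ 2)) :=
        Finset.sum_le_sum fun i _ =>
          norm_add_norm_sub_le (norm_pos_iff.1 hw0) (b.norm_eq_one i) h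
    _ = h ^ 2 / ‖w‖ * ((Fintype.card ι : ℝ) - ‖w‖ ^ 2 / (‖w‖ ^ 2 + h ^ 2)) := by
        rw [← Finset.mul_sum, Finset.sum_sub_distrib, ← Finset.sum_div]
        congr 3
        · simp
        · rw [← b.sum_sq_inner_left w]
    _ = h ^ 2 * (‖w‖⁻¹ * ((Fintype.card ι : ℝ) - 1 + h ^ 2 / (‖w‖ ^ 2 + h ^ 2))) := by
        have : ‖w‖ ^ 2 + h ^ 2 ≠ 0 := by positivity
        field_simp
        ring
    _ ≤ h ^ 2 * (ρ⁻¹ * ((Fintype.card ι : ℝ) - 1 + h ^ 2 / ρ ^ 2)) := by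
        have h2 : ρ ^ 2 ≤ ‖w‖ ^ 2 + h ^ 2 := by nlinarith [sq_nonneg h]
        have : 0 ≤ (Fintype.card ι : ℝ) - 1 := by linarith
        gcongr

lemma abs_sum_second_diff_distB_le (hd : 1 ≤ d) (hΩ : IsOpen Ω)
    {p y : EuclideanSpace ℝ (Fin d)} {u : ℝ} (hu : 0 < u) (hp : p ∈ frontier Ω)
    (hball : TwoSidedBall Ω u p) (hy : y ∈ Ω) (hyp : dist y p = distB Ω y)
    (hyu : distB Ω y ≤ u / 2) (b : OrthonormalBasis (Fin d) ℝ (EuclideanSpace ℝ (Fin d)))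
    {h : ℝ} (hadd : ∀ i, y + h • b i ∈ Ω) (hsub : ∀ i, y - h • b i ∈ Ω) :
    |∑ i, (distB Ω (y + h • b i) + distB Ω (y - h • b i) - 2 * distB Ω y)| ≤
      h ^ 2 * ((u / 2)⁻¹ * ((d : ℝ) - 1 + h ^ 2 / (u / 2) ^ 2)) := by
  obtain ⟨ν, hν, hin, hout⟩ := hball.exists_normal hΩ hu hp
  have hne : (frontier Ω).Nonempty := ⟨p, hp⟩
  have hyν := eq_add_smul_normal hΩ hu hp hν hout hy hyp
  have hs := distB_pos hΩ hne hy
  have hu2 : 0 < u / 2 := by positivity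
  have h1 : ‖y - (p + u • ν)‖ = u - distB Ω y := by
    have : y - (p + u • ν) = (distB Ω y - u) • ν := by
      nth_rw 1 [hyν]; rw [sub_smul]; abel
    rw [this, norm_smul, hν, mul_one, Real.norm_eq_abs, abs_of_nonpos (by linarith)]
    ring
  have h2 : ‖y - (p - u • ν)‖ = u + distB Ω y := by
    have : y - (p - u • ν) = (distB Ω y + u) • ν := by
      nth_rw 1 [hyν]; rw [add_smul]; abel
    rw [this, norm_smul, hν, mul_one, Real.norm_eq_abs, abs_of_nonneg (by linarith)]
    ring
  have hc : 1 ≤ Fintype.card (Fin d) := by simpa using hd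
  have b1 := sum_norm_add_norm_sub_le b (w := y - (p + u • ν)) hu2 (by linarith) hc h
  have b2 := sum_norm_add_norm_sub_le b (w := y - (p - u • ν)) hu2 (by linarith) hc h
  rw [Fintype.card_fin] at b1 b2
  rw [abs_le]
  constructor
  · refine (neg_le_neg b1).trans ?_
    rw [← Finset.sum_neg_distrib]
    refine Finset.sum_le_sum fun i _ => ?_
    have e1 := sub_norm_le_distB hne hΩ hin (y + h • b i)
    have e2 := sub_norm_le_distB hne hΩ hin (y - h • b i)
    rw [add_sub_right_comm] at e1
    rw [sub_right_comm] at e2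
    linarith
  · refine le_trans (Finset.sum_le_sum fun i _ => ?_) b2
    have e1 := distB_le_norm_sub hne hΩ hu hout (hadd i)
    have e2 := distB_le_norm_sub hne hΩ hu hout (hsub i)
    rw [add_sub_right_comm] at e1
    rw [sub_right_comm] at e2
    linarith

lemma lipschitzWith_distB : LipschitzWith 1 (distB Ω) := lipschitz_infDist_pt _

lemma norm_fderiv_distB {p y : EuclideanSpace ℝ (Fin d)} (hp : p ∈ frontier Ω)
    (hpos : 0 < distB Ω y) (hyp : dist y p = distB Ω y) (hdiff : DifferentiableAt ℝ (distB Ω) y) :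
    ‖fderiv ℝ (distB Ω) y‖ = 1 := by
  refine le_antisymm (by simpa using norm_fderiv_le_of_lipschitz ℝ lipschitzWith_distB) ?_
  set s := distB Ω y with hs
  have hn : ‖p - y‖ = s := by rw [← dist_eq_norm, dist_comm, hyp]
  have key : fderiv ℝ (distB Ω) y (p - y) ≤ -s := by
    have hl : HasDerivAt (fun t : ℝ => distB Ω (y + t • (p - y)))
        (fderiv ℝ (distB Ω) y (p - y)) 0 := hdiff.hasFDerivAt.hasLineDerivAt (p - y)
    have ht := (hasDerivAt_iff_tendsto_slope.1 hl).mono_left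
      (nhdsWithin_mono _ (fun t (ht : t ∈ Ioi (0 : ℝ)) => (ne_of_gt ht : t ≠ 0)))
    refine le_of_tendsto ht ?_
    filter_upwards [self_mem_nhdsWithin, nhdsWithin_le_nhds (Iio_mem_nhds (zero_lt_one' ℝ))]
      with t ht0 ht1
    have ht0 : 0 < t := ht0
    have ht1 : t < 1 := ht1
    have h1 : distB Ω (y + t • (p - y)) ≤ (1 - t) * s := by
      refine (infDist_le_dist_of_mem hp).trans_eq ?_
      have : y + t • (p - y) - p = (1 - t) • (y - p) := by
        rw [sub_smul, one_smul, ← neg_sub y p, smul_neg]; abel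
      rw [dist_eq_norm, this, norm_smul, ← dist_eq_norm y p, hyp, Real.norm_eq_abs,
        abs_of_pos (by linarith)]
    rw [slope_def_field]
    simp only [zero_smul, add_zero, sub_zero]
    rw [div_le_iff₀ ht0, ← hs]
    linarith
  have h2 := (fderiv ℝ (distB Ω) y).le_opNorm (p - y)
  rw [hn, Real.norm_eq_abs] at h2
  have h3 := neg_abs_le (fderiv ℝ (distB Ω) y (p - y))
  have : 1 * s ≤ ‖fderiv ℝ (distB Ω) y‖ * s := by linarith
  exact le_of_mul_le_mul_right this hpos

end Geometry

lemma lineDeriv_eq_zero_of_notMem_tsupport {E : Type*} [NormedAddCommGroup E]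
    [NormedSpace ℝ E] {g : E → ℝ} {y : E} (hy : y ∉ tsupport g) (v : E) :
    lineDeriv ℝ g y v = 0 := by
  have h : g =ᶠ[𝓝 y] fun _ => 0 := notMem_tsupport_iff_eventuallyEq.1 hy
  rw [h.lineDeriv_eq]
  simp [lineDeriv]

lemma integral_mul_second_diff {E : Type*} [NormedAddCommGroup E] [MeasurableSpace E]
    [BorelSpace E] {μ : Measure E} [μ.IsAddHaarMeasure] {f g : E → ℝ}
    (hf : Continuous f) (hg : Continuous g)
    (hgc : HasCompactSupport g) (w : E) :
    ∫ y, g y * (f (y + w) + f (y - w) - 2 * f y) ∂μ =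
      -∫ y, (f (y + w) - f y) * (g (y + w) - g y) ∂μ := by
  have hint : ∀ {k : E → ℝ}, Continuous k → Integrable (fun y => g y * k y) μ := fun hk =>
    (hg.mul hk).integrable_of_hasCompactSupport hgc.mul_right
  have i1 : Integrable (fun y => g y * (f (y + w) - f y)) μ := hint (by fun_prop)
  have i2 : Integrable (fun y => g y * (f y - f (y - w))) μ := hint (by fun_prop)
  have i3 : Integrable (fun y => g (y + w) * (f (y + w) - f (y + w - w))) μ :=
    i2.comp_add_right w
  have e2 : ∫ y, g y * (f y - f (y - w)) ∂μ =
      ∫ y, g (y + w) * (f (y + w) - f (y + w - w)) ∂μ :=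
    (integral_add_right_eq_self (fun y => g y * (f y - f (y - w))) w).symm
  calc ∫ y, g y * (f (y + w) + f (y - w) - 2 * f y) ∂μ
      = ∫ y, (g y * (f (y + w) - f y) - g y * (f y - f (y - w))) ∂μ := by
        congr 1; ext y; ring
    _ = ∫ y, (g y * (f (y + w) - f y) - g (y + w) * (f (y + w) - f (y + w - w))) ∂μ := by
        rw [integral_sub i1 i2, e2, integral_sub i1 i3]
    _ = -∫ y, (f (y + w) - f y) * (g (y + w) - g y) ∂μ := by
        rw [← integral_neg]; congr 1; ext y; rw [add_sub_cancel_right]; ring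

section SecondDifference

variable {E : Type*} [NormedAddCommGroup E] [NormedSpace ℝ E] [MeasurableSpace E] [BorelSpace E]
  [FiniteDimensional ℝ E] {μ : Measure E} [μ.IsAddHaarMeasure]

omit [FiniteDimensional ℝ E] in
lemma integrable_lineDeriv_mul_lineDeriv {f g : E → ℝ} {C D : NNReal} (hf : LipschitzWith C f)
    (hg : LipschitzWith D g) (hgc : HasCompactSupport g) (v : E) :
    Integrable (fun y => lineDeriv ℝ f y v * lineDeriv ℝ g y v) μ := by
  have hi : Integrable ((tsupport g).indicator fun _ => (C * ‖v‖) * (D * ‖v‖)) μ :=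
    (integrableOn_const hgc.isCompact.measure_lt_top.ne).integrable_indicator
      (isClosed_tsupport g).measurableSet
  refine hi.mono' ((aestronglyMeasurable_lineDeriv hf.continuous μ).mul
    (aestronglyMeasurable_lineDeriv hg.continuous μ)) (Eventually.of_forall fun y => ?_)
  by_cases hy : y ∈ tsupport g
  · rw [indicator_of_mem hy, norm_mul]
    gcongr
    · exact norm_lineDeriv_le_of_lipschitz ℝ hf
    · exact norm_lineDeriv_le_of_lipschitz ℝ hg
  · rw [indicator_of_notMem hy, lineDeriv_eq_zero_of_notMem_tsupport hy]
    simp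

lemma tendsto_integral_mul_second_diff {f g : E → ℝ} {C D : NNReal} (hf : LipschitzWith C f)
    (hg : LipschitzWith D g) (hgc : HasCompactSupport g) (v : E) :
    Tendsto (fun h : ℝ => (h ^ 2)⁻¹ * ∫ y, g y * (f (y + h • v) + f (y - h • v) - 2 * f y) ∂μ)
      (𝓝[>] 0) (𝓝 (-∫ y, lineDeriv ℝ f y v * lineDeriv ℝ g y v ∂μ)) := by
  have key : Tendsto (fun h : ℝ => ∫ y, (h⁻¹ • (f (y + h • v) - f y)) *
      (h⁻¹ • (g (y + h • v) - g y)) ∂μ) (𝓝[>] 0)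
      (𝓝 (∫ y, lineDeriv ℝ f y v * lineDeriv ℝ g y v ∂μ)) := by
    have hKc : IsCompact (cthickening ‖v‖ (tsupport g)) := hgc.isCompact.cthickening
    refine tendsto_integral_filter_of_dominated_convergence
      ((cthickening ‖v‖ (tsupport g)).indicator fun _ => (C * ‖v‖) * (D * ‖v‖)) ?_ ?_ ?_ ?_
    · refine Eventually.of_forall fun h => Continuous.aestronglyMeasurable ?_
      have := hf.continuous
      have := hg.continuous
      fun_prop
    · filter_upwards [Ioc_mem_nhdsGT (zero_lt_one' ℝ)] with h hh
      have hlip : ∀ {k : E → ℝ} {L : NNReal}, LipschitzWith L k → ∀ y,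
          ‖h⁻¹ • (k (y + h • v) - k y)‖ ≤ L * ‖v‖ := by
        intro k L hk y
        have h1 := hk.dist_le_mul (y + h • v) y
        rw [dist_self_add_left, norm_smul, Real.norm_eq_abs, abs_of_pos hh.1, dist_eq_norm] at h1
        rw [norm_smul, norm_inv, Real.norm_eq_abs, abs_of_pos hh.1, inv_mul_le_iff₀ hh.1]
        linarith
      refine Eventually.of_forall fun y => ?_
      by_cases hy : y ∈ cthickening ‖v‖ (tsupport g)
      · rw [indicator_of_mem hy, norm_mul]
        gcongr
        · exact hlip hf y
        · exact hlip hg y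
      · have h1 : g y = 0 := image_eq_zero_of_notMem_tsupport fun h' =>
          hy (self_subset_cthickening _ h')
        have h2 : g (y + h • v) = 0 := image_eq_zero_of_notMem_tsupport fun h' =>
          hy (mem_cthickening_of_dist_le _ _ _ _ h' (by
            rw [dist_self_add_right, norm_smul, Real.norm_eq_abs, abs_of_pos hh.1]
            exact mul_le_of_le_one_left (norm_nonneg _) hh.2))
        rw [indicator_of_notMem hy, h1, h2]
        simp
    · exact (integrableOn_const hKc.measure_lt_top.ne).integrable_indicator
        hKc.isClosed.measurableSet
    · filter_upwards [hf.ae_lineDifferentiableAt v, hg.ae_lineDifferentiableAt v] with y h1 h2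
      exact h1.hasLineDerivAt.tendsto_slope_zero_right.mul
        h2.hasLineDerivAt.tendsto_slope_zero_right
  refine key.neg.congr fun h => ?_
  rw [integral_mul_second_diff hf.continuous hg.continuous hgc, mul_neg, ← integral_const_mul]
  congr 2
  ext y
  simp only [smul_eq_mul]
  rw [sq, mul_inv]
  ring

end SecondDifference

lemma LipschitzWith.mul_of_bounded {α : Type*} [PseudoMetricSpace α] {f g : α → ℝ}
    {C D A B : NNReal} (hf : LipschitzWith C f) (hg : LipschitzWith D g)
    (hA : ∀ y, |f y| ≤ A) (hB : ∀ y, |g y| ≤ B) :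
    LipschitzWith (A * D + B * C) fun y => f y * g y := by
  refine LipschitzWith.of_dist_le_mul fun y z => ?_
  have h1 := hf.dist_le_mul y z
  have h2 := hg.dist_le_mul y z
  rw [Real.dist_eq] at h1 h2 ⊢
  have e : f y * g y - f z * g z = f y * (g y - g z) + g z * (f y - f z) := by ring
  rw [e]
  refine (abs_add_le _ _).trans ?_
  rw [abs_mul, abs_mul]
  push_cast
  have h3 := mul_le_mul (hA y) h2 (abs_nonneg _) A.2
  have h4 := mul_le_mul (hB z) h1 (abs_nonneg _) B.2
  linarith

section Weights

variable {d : ℕ} {Ω : Set (EuclideanSpace ℝ (Fin d))}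

lemma continuous_distB_rpow_mul (hΩ : IsOpen Ω) (hne : (frontier Ω).Nonempty) (p : ℝ)
    {f : EuclideanSpace ℝ (Fin d) → ℝ} (hf : Continuous f) (hs : tsupport f ⊆ Ω) :
    Continuous fun y => distB Ω y ^ p * f y := by
  refine continuous_of_tsupport fun y hy => ?_
  have hyΩ : y ∈ Ω := hs (closure_mono (Function.support_mul_subset_right _ _) hy)
  exact (((lipschitzWith_distB (Ω := Ω)).continuous.continuousAt).rpow_const
    (Or.inl (distB_pos hΩ hne hyΩ).ne')).mul hf.continuousAt

lemma integrable_distB_rpow_mul (hΩ : IsOpen Ω) (hne : (frontier Ω).Nonempty) (p : ℝ)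
    {f : EuclideanSpace ℝ (Fin d) → ℝ} (hf : Continuous f) (hc : HasCompactSupport f)
    (hs : tsupport f ⊆ Ω) : Integrable fun y => distB Ω y ^ p * f y :=
  (continuous_distB_rpow_mul hΩ hne p hf hs).integrable_of_hasCompactSupport hc.mul_left

lemma L2N_distB_rpow_mul (hΩ : IsOpen Ω) (hne : (frontier Ω).Nonempty) (p : ℝ)
    {f : EuclideanSpace ℝ (Fin d) → ℝ} (hf : Continuous f) (hc : HasCompactSupport f)
    (hs : tsupport f ⊆ Ω) :
    L2N (fun y => distB Ω y ^ p * f y) =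
      ENNReal.ofReal (√(∫ y, distB Ω y ^ (2 * p) * f y ^ 2)) := by
  have hm : MemLp (fun y => distB Ω y ^ p * f y) 2 volume :=
    (continuous_distB_rpow_mul hΩ hne p hf hs).memLp_of_hasCompactSupport hc.mul_left
  have e : ∫ y, ‖distB Ω y ^ p * f y‖ ^ (2 : ℝ≥0∞).toReal = ∫ y, distB Ω y ^ (2 * p) * f y ^ 2 := by
    refine integral_congr_ae (Eventually.of_forall fun y => ?_)
    have h0 : 0 ≤ distB Ω y := infDist_nonneg
    simp only [toReal_ofNat, Real.rpow_ofNat, Real.norm_eq_abs, sq_abs, mul_pow]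
    rw [mul_comm 2 p, Real.rpow_mul h0, Real.rpow_ofNat]
  rw [L2N, hm.eLpNorm_eq_integral_rpow_norm (by norm_num) (by norm_num), e, Real.sqrt_eq_rpow]
  norm_num

lemma tsupport_norm_fderiv_subset (ψ : EuclideanSpace ℝ (Fin d) → ℝ) :
    tsupport (fun y => ‖fderiv ℝ ψ y‖) ⊆ tsupport ψ :=
  closure_minimal (fun y hy => tsupport_fderiv_subset ℝ (subset_closure (by simpa using hy)))
    (isClosed_tsupport ψ)

lemma bHardy_iff (hΩ : IsOpen Ω) (hne : (frontier Ω).Nonempty) {δ a : ℝ} (ha : 0 ≤ a)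
    {S : Set (EuclideanSpace ℝ (Fin d))} (hS : S ⊆ Ω) :
    BHardy Ω δ S a ↔ ∀ ψ, IsCc1 S ψ →
      ∫ y, distB Ω y ^ (δ - 2) * ψ y ^ 2 ≤
        a ^ 2 * ∫ y, distB Ω y ^ δ * ‖fderiv ℝ ψ y‖ ^ 2 := by
  refine forall₂_congr fun ψ hψ => ?_
  have hs := hψ.2.2.trans hS
  have hgc : HasCompactSupport fun y => ‖fderiv ℝ ψ y‖ := (hψ.2.1.fderiv ℝ).norm
  rw [wNorm, wGradNorm, L2N_distB_rpow_mul hΩ hne _ hψ.1.continuous hψ.2.1 hs,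
    L2N_distB_rpow_mul hΩ hne _ (hψ.1.continuous_fderiv one_ne_zero).norm hgc
      ((tsupport_norm_fderiv_subset ψ).trans hs), ← ENNReal.ofReal_mul ha,
    ENNReal.ofReal_le_ofReal_iff (by positivity), ← Real.sqrt_sq ha,
    ← Real.sqrt_mul (sq_nonneg a), Real.sqrt_sq ha, Real.sqrt_le_sqrt_iff]
  · rw [show 2 * (δ / 2 - 1) = δ - 2 by ring, show 2 * (δ / 2) = δ by ring]
  · have : 0 ≤ ∫ y, distB Ω y ^ (2 * (δ / 2)) * ‖fderiv ℝ ψ y‖ ^ 2 :=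
      integral_nonneg fun y => mul_nonneg (Real.rpow_nonneg infDist_nonneg _) (sq_nonneg _)
    positivity

lemma exists_lipschitzWith_distB_rpow_mul (hΩ : IsOpen Ω) (hne : (frontier Ω).Nonempty) (p : ℝ)
    {f : EuclideanSpace ℝ (Fin d) → ℝ} (hf : ContDiff ℝ 1 f) (hc : HasCompactSupport f)
    (hs : tsupport f ⊆ Ω) : ∃ C, LipschitzWith C fun y => distB Ω y ^ p * f y := by
  obtain ⟨ε, hε, hεD⟩ := hc.isCompact.exists_forall_le'
    lipschitzWith_distB.continuous.continuousOn fun y hy => distB_pos hΩ hne (hs hy)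
  obtain ⟨M, hM⟩ := (hc.isCompact.image (lipschitzWith_distB (Ω := Ω)).continuous).bddAbove
  set N := max ε M
  have hεN : ε ≤ N := le_max_left _ _
  have hcd : ContDiffOn ℝ 1 (fun t : ℝ => t ^ p) (Icc ε N) := fun t ht =>
    (Real.contDiffAt_rpow_const_of_ne (hε.trans_le ht.1).ne').contDiffWithinAt
  obtain ⟨K, hK⟩ := hcd.exists_lipschitzOnWith one_ne_zero (convex_Icc ε N) isCompact_Icc
  obtain ⟨B, hB⟩ := isCompact_Icc.exists_bound_of_continuousOn hcd.continuousOn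
  obtain ⟨B', hB'⟩ := hf.continuous.bounded_above_of_compact_support hc
  obtain ⟨L, hL⟩ : ∃ L, LipschitzWith L f :=
    ContDiff.lipschitzWith_of_hasCompactSupport hc hf one_ne_zero
  have h1 : LipschitzWith (K * 1 * 1) fun y => (projIcc ε N hεN (distB Ω y) : ℝ) ^ p := by
    have h2 : LipschitzWith K ((Icc ε N).domRestrict fun t : ℝ => t ^ p) :=
      lipschitzOnWith_iff_restrict.1 hK
    exact (h2.comp (LipschitzWith.projIcc hεN)).comp lipschitzWith_distB
  have h3 := h1.mul_of_bounded hL (A := ⟨|B|, abs_nonneg B⟩) (B := ⟨|B'|, abs_nonneg B'⟩)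
    (fun y => (hB _ (projIcc ε N hεN (distB Ω y)).2).trans (le_abs_self _))
    (fun y => (hB' y).trans (le_abs_self _))
  refine ⟨_, (?_ : (fun y => (projIcc ε N hεN (distB Ω y) : ℝ) ^ p * f y) =
    fun y => distB Ω y ^ p * f y) ▸ h3⟩
  ext y
  by_cases hy : y ∈ tsupport f
  · rw [projIcc_of_mem hεN ⟨hεD y hy, (hM (mem_image_of_mem _ hy)).trans (le_max_right _ _)⟩]
  · rw [image_eq_zero_of_notMem_tsupport hy, mul_zero, mul_zero]

end Weights
section HardyInequality

variable {d : ℕ} {Ω : Set (EuclideanSpace ℝ (Fin d))}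

lemma abs_sum_integral_lineDeriv_distB_le (hd : 1 ≤ d) (hΩ : IsOpen Ω)
    {U : Set (EuclideanSpace ℝ (Fin d))} {u : ℝ} (hu : 0 < u)
    (hball : ∀ y ∈ frontier Ω ∩ U, TwoSidedBall Ω u y)
    (b : OrthonormalBasis (Fin d) ℝ (EuclideanSpace ℝ (Fin d)))
    {φ : EuclideanSpace ℝ (Fin d) → ℝ} {C : NNReal} (hφ : LipschitzWith C φ)
    (hφ0 : ∀ y, 0 ≤ φ y) (hc : HasCompactSupport φ) (hsΩ : tsupport φ ⊆ Ω)
    (hsu : ∀ y ∈ tsupport φ, distB Ω y ≤ u / 2)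
    (hnear : ∀ y ∈ tsupport φ, ∃ p ∈ frontier Ω ∩ U, dist y p = distB Ω y) :
    |∑ i, ∫ y, lineDeriv ℝ (distB Ω) y (b i) * lineDeriv ℝ φ y (b i)| ≤
      (u / 2)⁻¹ * ((d : ℝ) - 1) * ∫ y, φ y := by
  obtain ⟨η, hη, hηΩ⟩ := hc.isCompact.exists_cthickening_subset_open hΩ hsΩ
  have hDc : Continuous (distB Ω) := lipschitzWith_distB.continuous
  have hlim := tendsto_finsetSum Finset.univ fun i _ =>
    tendsto_integral_mul_second_diff (μ := volume) (lipschitzWith_distB (Ω := Ω)) hφ hc (b i)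
  have hlim2 : Tendsto
      (fun h : ℝ => (u / 2)⁻¹ * ((d : ℝ) - 1 + h ^ 2 / (u / 2) ^ 2) * ∫ y, φ y) (𝓝[>] 0)
      (𝓝 ((u / 2)⁻¹ * ((d : ℝ) - 1) * ∫ y, φ y)) := by
    refine Tendsto.mono_left ?_ nhdsWithin_le_nhds
    have : Continuous (fun h : ℝ =>
        (u / 2)⁻¹ * ((d : ℝ) - 1 + h ^ 2 / (u / 2) ^ 2) * ∫ y, φ y) := by fun_prop
    simpa using this.tendsto 0
  rw [← abs_neg, ← Finset.sum_neg_distrib]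
  refine le_of_tendsto_of_tendsto hlim.abs hlim2 ?_
  filter_upwards [Ioc_mem_nhdsGT hη] with h hh
  have hmem : ∀ y ∈ tsupport φ, ∀ i, y + h • b i ∈ Ω ∧ y - h • b i ∈ Ω := by
    intro y hy i
    have hn : ‖h • b i‖ ≤ η := by
      rw [norm_smul, b.norm_eq_one, mul_one, Real.norm_eq_abs, abs_of_pos hh.1]
      exact hh.2
    exact ⟨hηΩ (mem_cthickening_of_dist_le _ _ _ _ hy (by rwa [dist_self_add_left])),
      hηΩ (mem_cthickening_of_dist_le _ _ _ _ hy (by rwa [dist_self_sub_left]))⟩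
  have hint : ∀ i, Integrable fun y => φ y *
      (distB Ω (y + h • b i) + distB Ω (y - h • b i) - 2 * distB Ω y) := fun i => by
    have := hφ.continuous
    have hcont : Continuous fun y => φ y *
        (distB Ω (y + h • b i) + distB Ω (y - h • b i) - 2 * distB Ω y) := by fun_prop
    exact hcont.integrable_of_hasCompactSupport hc.mul_right
  rw [← Finset.mul_sum, ← integral_finsetSum _ fun i _ => hint i, abs_mul, abs_inv,
    abs_of_pos (by have := hh.1; positivity : 0 < h ^ 2),
    inv_mul_le_iff₀ (by have := hh.1; positivity), ← mul_assoc, ← integral_const_mul]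
  refine abs_integral_le_integral_abs.trans (integral_mono_of_nonneg
    (Eventually.of_forall fun y => abs_nonneg _)
    ((hφ.continuous.integrable_of_hasCompactSupport hc).const_mul _)
    (Eventually.of_forall fun y => ?_))
  simp only
  rw [← Finset.mul_sum, abs_mul, abs_of_nonneg (hφ0 y), mul_comm]
  by_cases hy : y ∈ tsupport φ
  · obtain ⟨p, hp, hyp⟩ := hnear y hy
    exact mul_le_mul_of_nonneg_right (abs_sum_second_diff_distB_le hd hΩ hu hp.1 (hball p hp)
      (hsΩ hy) hyp (hsu y hy) b (fun i => (hmem y hy i).1) fun i => (hmem y hy i).2) (hφ0 y)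
  · rw [image_eq_zero_of_notMem_tsupport hy, mul_zero, mul_zero]

lemma abs_sum_lineDeriv_sub_le (hΩ : IsOpen Ω) (hne : (frontier Ω).Nonempty) (δ : ℝ)
    (b : OrthonormalBasis (Fin d) ℝ (EuclideanSpace ℝ (Fin d)))
    {ψ : EuclideanSpace ℝ (Fin d) → ℝ} {y : EuclideanSpace ℝ (Fin d)} (hy : y ∈ Ω)
    (hψ : DifferentiableAt ℝ ψ y) (hD : DifferentiableAt ℝ (distB Ω) y) :
    |∑ i, lineDeriv ℝ (distB Ω) y (b i) *
        lineDeriv ℝ (fun y => distB Ω y ^ (δ - 1) * ψ y ^ 2) y (b i) -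
      (δ - 1) * (distB Ω y ^ (δ - 2) * ψ y ^ 2)| ≤
      2 * (distB Ω y ^ (δ - 1) * (|ψ y| * ‖fderiv ℝ ψ y‖)) := by
  have hpos := distB_pos hΩ hne hy
  obtain ⟨p, hp, hyp⟩ := isClosed_frontier.exists_infDist_eq_dist hne y
  have hnorm := norm_fderiv_distB hp hpos hyp.symm hD
  have hφ : HasFDerivAt (fun y => distB Ω y ^ (δ - 1) * ψ y ^ 2)
      (distB Ω y ^ (δ - 1) • ((2 * ψ y) • fderiv ℝ ψ y) +
        ψ y ^ 2 • (((δ - 1) * distB Ω y ^ (δ - 2)) • fderiv ℝ (distB Ω) y)) y := by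
    have h1 := hD.hasFDerivAt.rpow_const (p := δ - 1) (Or.inl hpos.ne')
    rw [show δ - 1 - 1 = δ - 2 by ring] at h1
    have h2 := hψ.hasFDerivAt.pow 2
    simp only [Nat.add_one_sub_one, pow_one, Nat.cast_ofNat, nsmul_eq_mul] at h2
    exact h1.mul h2
  have hsum : ∀ L M : EuclideanSpace ℝ (Fin d) →L[ℝ] ℝ, ∑ i, L (b i) * M (b i) =
      ⟪(InnerProductSpace.toDual ℝ _).symm L, (InnerProductSpace.toDual ℝ _).symm M⟫ := by
    intro L M
    rw [← b.sum_inner_mul_inner]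
    refine Finset.sum_congr rfl fun i _ => ?_
    rw [InnerProductSpace.toDual_symm_apply, real_inner_comm, InnerProductSpace.toDual_symm_apply]
  have e1 : ∑ i, fderiv ℝ (distB Ω) y (b i) * fderiv ℝ (distB Ω) y (b i) = 1 := by
    rw [hsum, real_inner_self_eq_norm_sq, LinearIsometryEquiv.norm_map, hnorm, one_pow]
  have e2 : |∑ i, fderiv ℝ (distB Ω) y (b i) * fderiv ℝ ψ y (b i)| ≤ ‖fderiv ℝ ψ y‖ := by
    rw [hsum]
    refine (abs_real_inner_le_norm _ _).trans ?_
    rw [LinearIsometryEquiv.norm_map, LinearIsometryEquiv.norm_map, hnorm, one_mul]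
  have e3 : ∑ i, lineDeriv ℝ (distB Ω) y (b i) *
        lineDeriv ℝ (fun y => distB Ω y ^ (δ - 1) * ψ y ^ 2) y (b i) =
      2 * ψ y * distB Ω y ^ (δ - 1) * ∑ i, fderiv ℝ (distB Ω) y (b i) * fderiv ℝ ψ y (b i) +
      (δ - 1) * (distB Ω y ^ (δ - 2) * ψ y ^ 2) *
        ∑ i, fderiv ℝ (distB Ω) y (b i) * fderiv ℝ (distB Ω) y (b i) := by
    rw [Finset.mul_sum, Finset.mul_sum, ← Finset.sum_add_distrib]
    refine Finset.sum_congr rfl fun i _ => ?_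
    rw [hD.lineDeriv_eq_fderiv, (hφ.hasLineDerivAt (b i)).lineDeriv]
    simp only [_root_.add_apply, _root_.smul_apply, smul_eq_mul]
    ring
  have h0 : 0 ≤ distB Ω y ^ (δ - 1) := Real.rpow_nonneg hpos.le _
  rw [e3, e1, mul_one, add_sub_cancel_right, abs_mul, abs_mul, abs_mul, abs_of_nonneg h0, abs_two]
  calc _ ≤ 2 * |ψ y| * distB Ω y ^ (δ - 1) * ‖fderiv ℝ ψ y‖ := by gcongr
    _ = _ := by ring

theorem bHardy_of_twoSidedBall (hd : 1 ≤ d) (hΩ : IsOpen Ω) (hne : (frontier Ω).Nonempty)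
    {U : Set (EuclideanSpace ℝ (Fin d))} {u : ℝ} (hu : 0 < u)
    (hball : ∀ y ∈ frontier Ω ∩ U, TwoSidedBall Ω u y)
    (hnear : ∀ y ∈ bdryLayer Ω u ∩ U, ∃ z ∈ frontier Ω ∩ U, dist y z = distB Ω y)
    {δ r : ℝ} (hru : r < u / 2) (hδr : 2 * ((d : ℝ) - 1) * (r / u) < |δ - 1|) :
    BHardy Ω δ (bdryLayer Ω r ∩ U) (2 / (|δ - 1| - 2 * ((d : ℝ) - 1) * (r / u))) := by
  set c := |δ - 1| - 2 * ((d : ℝ) - 1) * (r / u) with hcdef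
  have hc0 : 0 < c := sub_pos.2 hδr
  have hd' : (1 : ℝ) ≤ d := by exact_mod_cast hd
  rw [bHardy_iff hΩ hne (by positivity) fun y hy => hy.1.1]
  rintro ψ ⟨hψ, hψc, hψs⟩
  have hψΩ : tsupport ψ ⊆ Ω := fun y hy => (hψs hy).1.1
  have hsq : tsupport (fun y => ψ y ^ 2) ⊆ tsupport ψ :=
    closure_mono fun y hy => by simpa using hy
  have hsqc : HasCompactSupport fun y => ψ y ^ 2 := hψc.mono' (subset_closure.trans hsq)
  have hgs : tsupport (fun y => |ψ y| * ‖fderiv ℝ ψ y‖) ⊆ tsupport ψ :=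
    closure_mono fun y hy => by
      simp only [Function.mem_support, ne_eq, mul_eq_zero, abs_eq_zero, not_or] at hy
      exact hy.1
  have hgs2 : tsupport (fun y => ‖fderiv ℝ ψ y‖ ^ 2) ⊆ tsupport ψ :=
    (closure_mono fun y hy => by simpa using hy).trans (tsupport_norm_fderiv_subset ψ)
  have hψf : Continuous (fderiv ℝ ψ) := hψ.continuous_fderiv one_ne_zero
  have hψ0 := hψ.continuous
  have iA : Integrable fun y => distB Ω y ^ (δ - 2) * ψ y ^ 2 :=
    integrable_distB_rpow_mul hΩ hne (δ - 2) (hψ0.pow 2) hsqc (hsq.trans hψΩ)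
  have iφ : Integrable fun y => distB Ω y ^ (δ - 1) * ψ y ^ 2 :=
    integrable_distB_rpow_mul hΩ hne (δ - 1) (hψ0.pow 2) hsqc (hsq.trans hψΩ)
  have iM : Integrable fun y => distB Ω y ^ (δ - 1) * (|ψ y| * ‖fderiv ℝ ψ y‖) :=
    integrable_distB_rpow_mul hΩ hne (δ - 1) (hψ0.abs.mul hψf.norm)
    (hψc.mono' (subset_closure.trans hgs)) (hgs.trans hψΩ)
  have iB : Integrable fun y => distB Ω y ^ δ * ‖fderiv ℝ ψ y‖ ^ 2 :=
    integrable_distB_rpow_mul hΩ hne δ (hψf.norm.pow 2)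
    (hψc.mono' (subset_closure.trans hgs2)) (hgs2.trans hψΩ)
  obtain ⟨C, hφ⟩ := exists_lipschitzWith_distB_rpow_mul hΩ hne (δ - 1) (hψ.pow 2) hsqc
    (hsq.trans hψΩ)
  set φ : EuclideanSpace ℝ (Fin d) → ℝ := fun y => distB Ω y ^ (δ - 1) * ψ y ^ 2 with hφdef
  have hφs : tsupport φ ⊆ tsupport ψ :=
    (closure_mono (Function.support_mul_subset_right _ _)).trans hsq
  have hφc : HasCompactSupport φ := hψc.mono' (subset_closure.trans hφs)
  have hD0 : ∀ y (p : ℝ), 0 ≤ distB Ω y ^ p := fun y p => Real.rpow_nonneg infDist_nonneg _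
  let b := EuclideanSpace.basisFun (Fin d) ℝ
  have hmain := abs_sum_integral_lineDeriv_distB_le hd hΩ hu hball b hφ
    (fun y => mul_nonneg (hD0 _ _) (sq_nonneg _)) hφc (hφs.trans hψΩ)
    (fun y hy => ((hψs (hφs hy)).1.2.trans hru).le)
    (fun y hy => hnear y ⟨⟨hψΩ (hφs hy), (hψs (hφs hy)).1.2.trans (by linarith)⟩,
      (hψs (hφs hy)).2⟩)
  have iX : ∀ i, Integrable fun y => lineDeriv ℝ (distB Ω) y (b i) * lineDeriv ℝ φ y (b i) :=
    fun i => integrable_lineDeriv_mul_lineDeriv lipschitzWith_distB hφ hφc _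
  rw [← integral_finsetSum _ fun i _ => iX i] at hmain
  have iXs := integrable_finsetSum Finset.univ fun i _ => iX i
  have hdiff : |(∫ y, ∑ i, lineDeriv ℝ (distB Ω) y (b i) * lineDeriv ℝ φ y (b i)) -
      (δ - 1) * ∫ y, distB Ω y ^ (δ - 2) * ψ y ^ 2| ≤
      2 * ∫ y, distB Ω y ^ (δ - 1) * (|ψ y| * ‖fderiv ℝ ψ y‖) := by
    rw [← integral_const_mul, ← integral_const_mul, ← integral_sub iXs (iA.const_mul _)]
    refine abs_integral_le_integral_abs.trans (integral_mono_ae (iXs.sub (iA.const_mul _)).abs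
      (iM.const_mul 2) ?_)
    filter_upwards [(lipschitzWith_distB (Ω := Ω)).ae_differentiableAt] with y hDy
    by_cases hy : y ∈ tsupport ψ
    · exact abs_sum_lineDeriv_sub_le hΩ hne δ b (hψΩ hy)
        (hψ.differentiable one_ne_zero y) hDy
    · simp [lineDeriv_eq_zero_of_notMem_tsupport fun h => hy (hφs h),
        image_eq_zero_of_notMem_tsupport hy]
  have hφA : ∫ y, φ y ≤ r * ∫ y, distB Ω y ^ (δ - 2) * ψ y ^ 2 := by
    rw [← integral_const_mul]
    refine integral_mono iφ (iA.const_mul r) fun y => ?_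
    by_cases hy : y ∈ tsupport ψ
    · have hpos := distB_pos hΩ hne (hψΩ hy)
      have e : distB Ω y ^ (δ - 1) = distB Ω y * distB Ω y ^ (δ - 2) := by
        rw [show δ - 1 = 1 + (δ - 2) by ring, Real.rpow_add hpos, Real.rpow_one]
      simp only [hφdef]
      rw [e, mul_assoc]
      exact mul_le_mul_of_nonneg_right (hψs hy).1.2.le (mul_nonneg (hD0 _ _) (sq_nonneg _))
    · simp [hφdef, image_eq_zero_of_notMem_tsupport hy]
  have hMAB : 2 * ∫ y, distB Ω y ^ (δ - 1) * (|ψ y| * ‖fderiv ℝ ψ y‖) ≤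
      c / 2 * (∫ y, distB Ω y ^ (δ - 2) * ψ y ^ 2) +
        2 / c * ∫ y, distB Ω y ^ δ * ‖fderiv ℝ ψ y‖ ^ 2 := by
    rw [← integral_const_mul, ← integral_const_mul, ← integral_const_mul,
      ← integral_add (iA.const_mul _) (iB.const_mul _)]
    refine integral_mono (iM.const_mul 2) ((iA.const_mul _).add (iB.const_mul _)) fun y => ?_
    by_cases hy : y ∈ tsupport ψ
    · have hpos := distB_pos hΩ hne (hψΩ hy)
      have e1 : distB Ω y ^ (δ - 1) = distB Ω y * distB Ω y ^ (δ - 2) := by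
        rw [show δ - 1 = 1 + (δ - 2) by ring, Real.rpow_add hpos, Real.rpow_one]
      have e2 : distB Ω y ^ δ = distB Ω y ^ 2 * distB Ω y ^ (δ - 2) := by
        rw [← Real.rpow_two, ← Real.rpow_add hpos]; congr 1; ring
      simp only
      rw [e1, e2, ← sub_nonneg]
      have : c / 2 * (distB Ω y ^ (δ - 2) * ψ y ^ 2) +
          2 / c * (distB Ω y ^ 2 * distB Ω y ^ (δ - 2) * ‖fderiv ℝ ψ y‖ ^ 2) -
          2 * (distB Ω y * distB Ω y ^ (δ - 2) * (|ψ y| * ‖fderiv ℝ ψ y‖)) =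
          (2 * c)⁻¹ * distB Ω y ^ (δ - 2) *
            (c * |ψ y| - 2 * (distB Ω y * ‖fderiv ℝ ψ y‖)) ^ 2 := by
        rw [← sq_abs (ψ y)]
        field_simp
        ring
      rw [this]
      have := hD0 y (δ - 2)
      positivity
    · have h0 : fderiv ℝ ψ y = 0 := image_eq_zero_of_notMem_tsupport fun h =>
        hy (tsupport_fderiv_subset ℝ h)
      simp [image_eq_zero_of_notMem_tsupport hy, h0]
  have hA0 : 0 ≤ ∫ y, distB Ω y ^ (δ - 2) * ψ y ^ 2 :=
    integral_nonneg fun y => mul_nonneg (hD0 _ _) (sq_nonneg _)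
  set A := ∫ y, distB Ω y ^ (δ - 2) * ψ y ^ 2
  set B := ∫ y, distB Ω y ^ δ * ‖fderiv ℝ ψ y‖ ^ 2
  set X := ∫ y, ∑ i, lineDeriv ℝ (distB Ω) y (b i) * lineDeriv ℝ φ y (b i)
  have h1 : |δ - 1| * A ≤ (u / 2)⁻¹ * ((d : ℝ) - 1) * (r * A) + (c / 2 * A + 2 / c * B) := by
    have h2 : |(δ - 1) * A| ≤ |X| + |X - (δ - 1) * A| := by
      rw [show (δ - 1) * A = X - (X - (δ - 1) * A) by ring]
      exact (abs_sub _ _).trans_eq (by ring_nf)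
    rw [abs_mul, abs_of_nonneg hA0] at h2
    have h3 : (u / 2)⁻¹ * ((d : ℝ) - 1) * ∫ y, φ y ≤ (u / 2)⁻¹ * ((d : ℝ) - 1) * (r * A) :=
      mul_le_mul_of_nonneg_left hφA (mul_nonneg (by positivity) (by linarith))
    linarith
  have h4 : (u / 2)⁻¹ * ((d : ℝ) - 1) * (r * A) = 2 * ((d : ℝ) - 1) * (r / u) * A := by
    field_simp
  have h5 : c / 2 * A ≤ 2 / c * B := by
    rw [h4] at h1
    rw [hcdef] at h1 ⊢
    linarith
  calc A = 2 / c * (c / 2 * A) := by field_simp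
    _ ≤ 2 / c * (2 / c * B) := by gcongr
    _ = _ := by ring

end HardyInequality

section LogSubstitution

lemma integral_Ioi_zero_eq_integral_exp_mul (F : ℝ → ℝ) :
    ∫ t in Ioi 0, F t = ∫ s, Real.exp s * F (Real.exp s) := by
  have h := integral_image_eq_integral_abs_deriv_smul MeasurableSet.univ
    (fun s _ => (Real.hasDerivAt_exp s).hasDerivWithinAt) Real.exp_injective.injOn F
  rw [image_univ, Real.range_exp] at h
  simpa [abs_of_pos (Real.exp_pos _)] using h

lemma integral_eq_integral_exp_mul {F : ℝ → ℝ} (hF : Function.support F ⊆ Ioi 0) :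
    ∫ t, F t = ∫ s, Real.exp s * F (Real.exp s) := by
  rw [← integral_Ioi_zero_eq_integral_exp_mul, setIntegral_eq_integral_of_forall_compl_eq_zero]
  exact fun t ht => Function.notMem_support.1 fun h => ht (hF h)

lemma integral_sq_le_of_hardy_line {δ a : ℝ}
    (H : ∀ f : ℝ → ℝ, ContDiff ℝ 1 f → HasCompactSupport f → tsupport f ⊆ Ioi 0 →
      ∫ t, t ^ (δ - 2) * f t ^ 2 ≤ a ^ 2 * ∫ t, t ^ δ * deriv f t ^ 2)
    {k : ℝ → ℝ} (hk : ContDiff ℝ 1 k) (hkc : HasCompactSupport k) :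
    ∫ s, k s ^ 2 ≤ a ^ 2 * ∫ s, ((1 - δ) / 2 * k s + deriv k s) ^ 2 := by
  set α := (1 - δ) / 2 with hα
  set f : ℝ → ℝ := (Ioi 0).indicator fun t => t ^ α * k (Real.log t) with hf
  have hfexp : ∀ s, f (Real.exp s) = Real.exp s ^ α * k s := fun s => by
    rw [hf, indicator_of_mem (mem_Ioi.2 (Real.exp_pos s)), Real.log_exp]
  have hK : IsCompact (Real.exp '' tsupport k) := hkc.isCompact.image Real.continuous_exp
  have hsupp : Function.support f ⊆ Real.exp '' tsupport k := by
    intro t ht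
    have ht0 : 0 < t := by
      by_contra h
      exact ht (indicator_of_notMem h _)
    refine ⟨Real.log t, subset_tsupport _ fun h => ht ?_, Real.exp_log ht0⟩
    rw [hf, indicator_of_mem (mem_Ioi.2 ht0), h, mul_zero]
  have hts : tsupport f ⊆ Real.exp '' tsupport k := closure_minimal hsupp hK.isClosed
  have hpos : tsupport f ⊆ Ioi 0 := hts.trans (by rintro _ ⟨s, -, rfl⟩; exact Real.exp_pos s)
  have hfeq : ∀ t, 0 < t → f =ᶠ[𝓝 t] fun t => t ^ α * k (Real.log t) := fun t ht => by
    filter_upwards [Ioi_mem_nhds ht] with s hs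
    rw [hf, indicator_of_mem hs]
  have hfC : ContDiff ℝ 1 f := by
    refine contDiff_iff_contDiffAt.2 fun t => ?_
    by_cases ht : t ∈ tsupport f
    swap
    · exact contDiffAt_const.congr_of_eventuallyEq (notMem_tsupport_iff_eventuallyEq.1 ht)
    have ht0 : t ≠ 0 := (hpos ht).ne'
    exact ((Real.contDiffAt_rpow_const_of_ne ht0).mul
      (hk.contDiffAt.comp t (Real.contDiffAt_log.2 ht0))).congr_of_eventuallyEq (hfeq t (hpos ht))
  have hder : ∀ s, deriv f (Real.exp s) = Real.exp s ^ (α - 1) * (α * k s + deriv k s) := by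
    intro s
    have hs := Real.exp_pos s
    have h1 : HasDerivAt (fun t => t ^ α * k (Real.log t)) _ (Real.exp s) :=
      (Real.hasDerivAt_rpow_const (p := α) (Or.inl hs.ne')).mul
        ((hk.differentiable one_ne_zero (Real.log (Real.exp s))).hasDerivAt.comp (Real.exp s)
          (Real.hasDerivAt_log hs.ne'))
    rw [(hfeq _ hs).deriv_eq, h1.deriv]
    simp only [Real.log_exp]
    rw [Real.rpow_sub_one hs.ne']
    field_simp
  have hmain := H f hfC (HasCompactSupport.of_support_subset_isCompact hK hsupp) hpos
  rw [integral_eq_integral_exp_mul (F := fun t => t ^ (δ - 2) * f t ^ 2),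
    integral_eq_integral_exp_mul (F := fun t => t ^ δ * deriv f t ^ 2)] at hmain
  · convert hmain using 2
    · ext s
      rw [hfexp, mul_pow, ← Real.exp_mul, ← Real.exp_mul, ← Real.exp_nat_mul, ← mul_assoc,
        ← mul_assoc, ← Real.exp_add, ← Real.exp_add,
        show s + s * (δ - 2) + (2 : ℕ) * (s * α) = 0 by rw [hα]; push_cast; ring, Real.exp_zero,
        one_mul]
    · congr 1
      ext s
      rw [hder, mul_pow, ← Real.exp_mul, ← Real.exp_mul, ← Real.exp_nat_mul, ← mul_assoc,
        ← mul_assoc, ← Real.exp_add, ← Real.exp_add,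
        show s + s * δ + (2 : ℕ) * (s * (α - 1)) = 0 by rw [hα]; push_cast; ring, Real.exp_zero,
        one_mul]
  · refine fun t ht => hpos (support_deriv_subset fun h => ht ?_)
    simp [h]
  · refine fun t ht => hpos (subset_tsupport _ fun h => ht ?_)
    simp [h]

end LogSubstitution

lemma exists_contDiff_integral_sq_pos :
    ∃ g : ℝ → ℝ, ContDiff ℝ 1 g ∧ HasCompactSupport g ∧ 0 < ∫ s, g s ^ 2 := by
  let g : ContDiffBump (0 : ℝ) := ⟨1, 2, one_pos, one_lt_two⟩
  refine ⟨g, g.contDiff, g.hasCompactSupport, ?_⟩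
  refine (g.continuous.pow 2).integral_pos_of_hasCompactSupport_nonneg_nonzero (x := 0)
    ?_ (fun s => sq_nonneg _) ?_
  · exact g.hasCompactSupport.mono fun s hs => by simpa using hs
  · have : g 0 = 1 := g.one_of_mem_closedBall (by simp [g])
    simp [this]

lemma deriv_comp_mul_left_real (g : ℝ → ℝ) (c s : ℝ) :
    deriv (fun s => g (c * s)) s = c * deriv g (c * s) := by
  rw [deriv_comp_mul_left, smul_eq_mul]

lemma hasCompactSupport_comp_mul_left {g : ℝ → ℝ} (hg : HasCompactSupport g) {c : ℝ}
    (hc : c ≠ 0) : HasCompactSupport fun s => g (c * s) :=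
  hg.comp_homeomorph (Homeomorph.mulLeft₀ c hc)

lemma exists_integral_sq_eq_one {ε : ℝ} (hε : 0 < ε) :
    ∃ g : ℝ → ℝ, ContDiff ℝ 1 g ∧ HasCompactSupport g ∧ ∫ s, g s ^ 2 = 1 ∧
      ∫ s, deriv g s ^ 2 ≤ ε := by
  obtain ⟨g, hg, hgc, hpos⟩ := exists_contDiff_integral_sq_pos
  set G := ∫ s, g s ^ 2
  set G' := ∫ s, deriv g s ^ 2 with hG'
  have hG'0 : 0 ≤ G' := integral_nonneg fun s => sq_nonneg _
  obtain ⟨c, hc, hcε⟩ : ∃ c : ℝ, 0 < c ∧ c ^ 2 * (G' / G) ≤ ε := by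
    have : Tendsto (fun c : ℝ => c ^ 2 * (G' / G)) (𝓝[>] 0) (𝓝 0) := by
      have h : Continuous fun c : ℝ => c ^ 2 * (G' / G) := by fun_prop
      simpa using (h.tendsto 0).mono_left nhdsWithin_le_nhds
    obtain ⟨c, hc1, hc2⟩ := ((this.eventually_le_const hε).and self_mem_nhdsWithin).exists
    exact ⟨c, hc2, hc1⟩
  set m := √(c / G)
  have hm : m ^ 2 = c / G := Real.sq_sqrt (by positivity)
  refine ⟨fun s => m * g (c * s), by fun_prop,
    (hasCompactSupport_comp_mul_left hgc hc.ne').mul_left, ?_, ?_⟩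
  · simp only [mul_pow]
    rw [integral_const_mul, Measure.integral_comp_mul_left (fun s => g s ^ 2),
      abs_of_pos (by positivity), hm, smul_eq_mul]
    change c / G * (c⁻¹ * G) = 1
    field_simp
  · have : ∀ s, deriv (fun s => m * g (c * s)) s = m * (c * deriv g (c * s)) := fun s => by
      rw [deriv_const_mul_field, deriv_comp_mul_left_real]
    simp only [this, mul_pow]
    rw [integral_const_mul, integral_const_mul,
      Measure.integral_comp_mul_left (fun s => deriv g s ^ 2),
      abs_of_pos (by positivity), hm, smul_eq_mul, ← hG']
    refine le_of_eq_of_le ?_ hcε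
    field_simp

lemma two_div_le_of_hardy_line {δ a : ℝ} (hδ : δ ≠ 1) (ha : 0 ≤ a)
    (H : ∀ f : ℝ → ℝ, ContDiff ℝ 1 f → HasCompactSupport f → tsupport f ⊆ Ioi 0 →
      ∫ t, t ^ (δ - 2) * f t ^ 2 ≤ a ^ 2 * ∫ t, t ^ δ * deriv f t ^ 2) :
    2 / |δ - 1| ≤ a := by
  set α := (1 - δ) / 2 with hα
  have key : ∀ ε : ℝ, 0 < ε → 1 ≤ a ^ 2 * ((1 + ε) * α ^ 2 + (1 + ε⁻¹) * ε ^ 2) := by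
    intro ε hε
    obtain ⟨k, hk, hkc, h1, h2⟩ := exists_integral_sq_eq_one (ε := ε ^ 2) (by positivity)
    have hk' := hk.continuous_deriv le_rfl
    have hk0 := hk.continuous
    have hkc' : HasCompactSupport (deriv k) := hkc.deriv
    have i1 : Integrable fun s => k s ^ 2 := by
      refine (hk0.pow 2).integrable_of_hasCompactSupport (hkc.mono fun s hs => ?_)
      simpa using hs
    have i2 : Integrable fun s => deriv k s ^ 2 := by
      refine (hk'.pow 2).integrable_of_hasCompactSupport (hkc'.mono fun s hs => ?_)
      simpa using hs
    have h3 := integral_sq_le_of_hardy_line H hk hkc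
    rw [h1] at h3
    refine h3.trans (mul_le_mul_of_nonneg_left ?_ (sq_nonneg a))
    calc ∫ s, (α * k s + deriv k s) ^ 2
        ≤ ∫ s, ((1 + ε) * α ^ 2 * k s ^ 2 + (1 + ε⁻¹) * deriv k s ^ 2) := by
          refine integral_mono_of_nonneg (Eventually.of_forall fun s => sq_nonneg _)
            ((i1.const_mul _).add (i2.const_mul _)) (Eventually.of_forall fun s => ?_)
          have : (1 + ε) * α ^ 2 * k s ^ 2 + (1 + ε⁻¹) * deriv k s ^ 2 -
              (α * k s + deriv k s) ^ 2 = ε⁻¹ * (ε * (α * k s) - deriv k s) ^ 2 := by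
            field_simp
            ring
          rw [← sub_nonneg]
          simp only
          rw [this]
          positivity
      _ = (1 + ε) * α ^ 2 + (1 + ε⁻¹) * ∫ s, deriv k s ^ 2 := by
          rw [integral_add (i1.const_mul _) (i2.const_mul _), integral_const_mul,
            integral_const_mul, h1, mul_one]
      _ ≤ _ := by gcongr
  have hlim : Tendsto (fun ε : ℝ => a ^ 2 * ((1 + ε) * α ^ 2 + (ε ^ 2 + ε))) (𝓝[>] 0)
      (𝓝 (a ^ 2 * α ^ 2)) := by
    have : Continuous fun ε : ℝ => a ^ 2 * ((1 + ε) * α ^ 2 + (ε ^ 2 + ε)) := by fun_prop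
    simpa using (this.tendsto 0).mono_left nhdsWithin_le_nhds
  have h1 : 1 ≤ a ^ 2 * α ^ 2 := by
    refine ge_of_tendsto hlim ?_
    filter_upwards [self_mem_nhdsWithin] with ε hε
    have h := key ε hε
    rwa [show (1 + ε⁻¹) * ε ^ 2 = ε ^ 2 + ε by
      have : ε ≠ 0 := ne_of_gt hε
      field_simp] at h
  have h2 : |α| = |δ - 1| / 2 := by rw [hα, abs_div, abs_sub_comm, abs_two]
  have h3 : 1 ≤ a * |α| := by
    rw [← mul_pow, ← sq_abs, one_le_sq_iff_one_le_abs, abs_abs, abs_mul, abs_of_nonneg ha] at h1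
    exact h1
  rw [h2] at h3
  rw [div_le_iff₀ (abs_pos.2 (sub_ne_zero.2 hδ))]
  linarith

section ProductTestFunctions

variable {ι E : Type*} [Fintype ι] [NormedAddCommGroup E] [InnerProductSpace ℝ E]

lemma norm_sq_eq_sum_sq (b : OrthonormalBasis ι ℝ E) [CompleteSpace E] (L : E →L[ℝ] ℝ) :
    ‖L‖ ^ 2 = ∑ i, L (b i) ^ 2 := by
  rw [← (InnerProductSpace.toDual ℝ E).symm.norm_map L, ← b.sum_sq_norm_inner_left]
  simp [InnerProductSpace.toDual_symm_apply]

lemma fderiv_prod_inner_apply [DecidableEq ι] (b : OrthonormalBasis ι ℝ E) {f : ι → ℝ → ℝ}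
    (hf : ∀ i, Differentiable ℝ (f i)) (w : E) (j : ι) :
    fderiv ℝ (fun w => ∏ i, f i ⟪b i, w⟫) w (b j) =
      ∏ i, (if i = j then deriv (f i) else f i) ⟪b i, w⟫ := by
  have h : ∀ i ∈ Finset.univ, HasFDerivAt (fun w => f i ⟪b i, w⟫)
      (deriv (f i) ⟪b i, w⟫ • innerSL ℝ (b i)) w := fun i _ =>
    (hf i _).hasDerivAt.comp_hasFDerivAt w (innerSL ℝ (b i)).hasFDerivAt
  rw [(HasFDerivAt.finsetProd h).fderiv]
  simp only [_root_.sum_apply, _root_.smul_apply, innerSL_apply_apply, smul_eq_mul,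
    b.inner_eq_ite]
  rw [Finset.sum_eq_single j (by intro i _ hij; simp [hij]) (by simp),
    ← Finset.mul_prod_erase _ _ (Finset.mem_univ j), if_pos rfl, if_pos rfl, mul_one, mul_comm]
  congr 1
  exact Finset.prod_congr rfl fun i hi => by rw [if_neg (Finset.ne_of_mem_erase hi)]

variable [FiniteDimensional ℝ E] [MeasurableSpace E] [BorelSpace E]

lemma integral_prod_inner (b : OrthonormalBasis ι ℝ E) (h : ι → ℝ → ℝ) :
    ∫ w, ∏ i, h i ⟪b i, w⟫ = ∏ i, ∫ t, h i t := by
  have h1 := b.measurePreserving_repr.integral_comp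
    b.repr.toHomeomorph.measurableEmbedding (fun v : EuclideanSpace ℝ ι => ∏ i, h i (v i))
  have h2 := (PiLp.volume_preserving_ofLp ι).integral_comp
    (MeasurableEquiv.toLp 2 (ι → ℝ)).symm.measurableEmbedding (fun v : ι → ℝ => ∏ i, h i (v i))
  rw [← integral_fintype_prod_volume_eq_prod]
  simpa [b.repr_apply_apply] using h1.trans h2

omit [FiniteDimensional ℝ E] [MeasurableSpace E] [BorelSpace E] in
lemma hasCompactSupport_prod_inner [Nonempty ι] (b : OrthonormalBasis ι ℝ E) {f : ι → ℝ → ℝ}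
    (hf : ∀ i, HasCompactSupport (f i)) : HasCompactSupport fun w => ∏ i, f i ⟪b i, w⟫ := by
  let e : E ≃ₜ (ι → ℝ) := b.repr.toHomeomorph.trans (EuclideanSpace.equiv ι ℝ).toHomeomorph
  have hK : IsCompact (univ.pi fun i => tsupport (f i)) := isCompact_univ_pi hf
  refine HasCompactSupport.of_support_subset_isCompact (e.isCompact_preimage.2 hK) fun w hw => ?_
  rw [mem_preimage, mem_univ_pi]
  intro i
  have h1 : f i ⟪b i, w⟫ ≠ 0 := Finset.prod_ne_zero_iff.1 hw i (Finset.mem_univ i)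
  have h2 : e w i = ⟪b i, w⟫ := b.repr_apply_apply w i
  rw [h2]
  exact subset_tsupport _ h1

lemma hardy_line_of_hardy_halfSpace {δ a : ℝ} (i₀ : ι) (b : OrthonormalBasis ι ℝ E)
    (H : ∀ χ : E → ℝ, ContDiff ℝ 1 χ → HasCompactSupport χ →
      tsupport χ ⊆ {w | 0 < ⟪b i₀, w⟫} →
      ∫ w, ⟪b i₀, w⟫ ^ (δ - 2) * χ w ^ 2 ≤ a ^ 2 * ∫ w, ⟪b i₀, w⟫ ^ δ * ‖fderiv ℝ χ w‖ ^ 2)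
    {f : ℝ → ℝ} (hf : ContDiff ℝ 1 f) (hfc : HasCompactSupport f) (hfs : tsupport f ⊆ Ioi 0) :
    ∫ t, t ^ (δ - 2) * f t ^ 2 ≤ a ^ 2 * ∫ t, t ^ δ * deriv f t ^ 2 := by
  classical
  set X := ∫ t, t ^ (δ - 2) * f t ^ 2
  set X₁ := ∫ t, t ^ δ * deriv f t ^ 2
  set X₀ := ∫ t, t ^ δ * f t ^ 2
  have hX₀ : 0 ≤ X₀ := integral_nonneg fun t => by
    by_cases ht : t ∈ tsupport f
    · exact mul_nonneg (Real.rpow_nonneg (hfs ht).le _) (sq_nonneg _)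
    · simp [image_eq_zero_of_notMem_tsupport ht]
  have key : ∀ ε : ℝ, 0 < ε → X ≤ a ^ 2 * (X₁ + ∑ _i ∈ Finset.univ.erase i₀, X₀ * ε) := by
    intro ε hε
    obtain ⟨g, hg, hgc, hg1, hgε⟩ := exists_integral_sq_eq_one hε
    set F : ι → ℝ → ℝ := fun i => if i = i₀ then f else g with hF
    have hFC : ∀ i, ContDiff ℝ 1 (F i) := fun i => by
      by_cases h : i = i₀ <;> simp [hF, h, hf, hg]
    have hFc : ∀ i, HasCompactSupport (F i) := fun i => by
      by_cases h : i = i₀ <;> simp [hF, h, hfc, hgc]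
    set χ : E → ℝ := fun w => ∏ i, F i ⟪b i, w⟫ with hχ
    have hχC : ContDiff ℝ 1 χ := contDiff_prod fun i _ =>
      (hFC i).comp (contDiff_const.inner ℝ contDiff_id)
    have : Nonempty ι := ⟨i₀⟩
    have hχc : HasCompactSupport χ := hasCompactSupport_prod_inner b hFc
    have hχs : tsupport χ ⊆ {w | 0 < ⟪b i₀, w⟫} := by
      have hcl : IsClosed ((fun w : E => ⟪b i₀, w⟫) ⁻¹' tsupport f) :=
        (isClosed_tsupport f).preimage (by fun_prop)
      refine (closure_minimal (fun w hw => ?_) hcl).trans fun w hw => hfs hw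
      have := Finset.prod_ne_zero_iff.1 hw i₀ (Finset.mem_univ i₀)
      rw [hF] at this
      simp only [if_true] at this
      exact subset_tsupport _ this
    have hL : ∫ w, ⟪b i₀, w⟫ ^ (δ - 2) * χ w ^ 2 = X := by
      have h1 : ∀ w, ⟪b i₀, w⟫ ^ (δ - 2) * χ w ^ 2 =
          ∏ i, (fun i t => (if i = i₀ then t ^ (δ - 2) else 1) * F i t ^ 2) i ⟪b i, w⟫ := by
        intro w
        simp only [Finset.prod_mul_distrib, Finset.prod_pow, hχ]
        rw [Finset.prod_ite_eq' Finset.univ i₀, if_pos (Finset.mem_univ _)]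
      refine (integral_congr_ae (Eventually.of_forall h1)).trans
        ((integral_prod_inner b fun i t =>
          (if i = i₀ then t ^ (δ - 2) else 1) * F i t ^ 2).trans ?_)
      rw [Finset.prod_eq_single i₀]
      · simp [hF, X]
      · intro i _ hi
        simp [hF, hi, hg1]
      · simp
    set P : ι → ι → ℝ → ℝ := fun j i t =>
      (if i = i₀ then t ^ δ else 1) * (if i = j then deriv (F i) else F i) t ^ 2 with hP
    have hPw : ∀ j w, ⟪b i₀, w⟫ ^ δ * fderiv ℝ χ w (b j) ^ 2 = ∏ i, P j i ⟪b i, w⟫ := by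
      intro j w
      rw [hχ, fderiv_prod_inner_apply b fun i => (hFC i).differentiable one_ne_zero]
      simp only [hP, Finset.prod_mul_distrib, Finset.prod_pow]
      rw [Finset.prod_ite_eq' Finset.univ i₀, if_pos (Finset.mem_univ _)]
    have hPi : ∀ j, Integrable fun w => ⟪b i₀, w⟫ ^ δ * fderiv ℝ χ w (b j) ^ 2 := by
      intro j
      have hc1 : Continuous fun w => fderiv ℝ χ w (b j) :=
        (hχC.continuous_fderiv one_ne_zero).clm_apply continuous_const
      have hsub : tsupport (fun w => ⟪b i₀, w⟫ ^ δ * fderiv ℝ χ w (b j) ^ 2) ⊆ tsupport χ := by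
        refine closure_minimal (fun w hw => tsupport_fderiv_subset ℝ (subset_closure ?_))
          (isClosed_tsupport χ)
        rw [Function.mem_support] at hw ⊢
        rintro h
        simp [h] at hw
      refine Continuous.integrable_of_hasCompactSupport (continuous_of_tsupport fun w hw => ?_)
        (hχc.mono' (subset_closure.trans hsub))
      exact ((continuousAt_const.inner continuousAt_id).rpow_const
        (Or.inl (hχs (hsub hw)).ne')).mul (hc1.continuousAt.pow 2)
    have hR : ∫ w, ⟪b i₀, w⟫ ^ δ * ‖fderiv ℝ χ w‖ ^ 2 = ∑ j, ∏ i, ∫ t, P j i t := by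
      simp only [norm_sq_eq_sum_sq b, Finset.mul_sum]
      rw [integral_finsetSum _ fun j _ => hPi j]
      refine Finset.sum_congr rfl fun j _ => ?_
      simp only [hPw]
      exact integral_prod_inner b (P j)
    have hmain := H χ hχC hχc hχs
    rw [hL, hR, ← Finset.add_sum_erase _ _ (Finset.mem_univ i₀)] at hmain
    refine hmain.trans (mul_le_mul_of_nonneg_left (add_le_add (le_of_eq ?_) ?_) (sq_nonneg a))
    · rw [Finset.prod_eq_single i₀]
      · simp [hP, hF, X₁]
      · intro i _ hi
        simp [hP, hF, hi, hg1]
      · simp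
    · refine Finset.sum_le_sum fun j hj => ?_
      have hj' := Finset.ne_of_mem_erase hj
      rw [Finset.prod_eq_mul i₀ j hj'.symm]
      · refine mul_le_mul (le_of_eq ?_) ?_ ?_ hX₀
        · simp [hP, hF, hj'.symm, X₀]
        · simpa [hP, hF, hj'] using hgε
        · simp only [hP, hj', if_false, if_true, one_mul]
          exact integral_nonneg fun t => sq_nonneg _
      · rintro i _ ⟨hi, hij⟩
        simp [hP, hF, hi, hij, hg1]
      · simp
      · simp
  have hlim : Tendsto (fun ε : ℝ => a ^ 2 * (X₁ + ∑ _i ∈ Finset.univ.erase i₀, X₀ * ε)) (𝓝[>] 0)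
      (𝓝 (a ^ 2 * X₁)) := by
    have : Continuous fun ε : ℝ => a ^ 2 * (X₁ + ∑ _i ∈ Finset.univ.erase i₀, X₀ * ε) := by
      fun_prop
    simpa using (this.tendsto 0).mono_left nhdsWithin_le_nhds
  exact ge_of_tendsto hlim (eventually_mem_nhdsWithin.mono key)

end ProductTestFunctions

section BlowUp

variable {d : ℕ} {Ω : Set (EuclideanSpace ℝ (Fin d))} {x ν : EuclideanSpace ℝ (Fin d)} {u : ℝ}

lemma norm_le_of_norm_sq_le {E : Type*} [NormedAddCommGroup E] {v : E} {u s : ℝ} (hu : 0 < u)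
    (h : ‖v‖ ^ 2 ≤ u ^ 2 + 2 * u * s) : ‖v‖ ≤ u + s := by
  nlinarith [sq_nonneg (‖v‖ - u)]

lemma abs_distB_add_smul_sub_le (hΩ : IsOpen Ω) (hx : x ∈ frontier Ω) (hu : 0 < u) (hν : ‖ν‖ = 1)
    (hin : ball (x + u • ν) u ⊆ Ω) (hout : Disjoint (ball (x - u • ν) u) Ω)
    {l : ℝ} (hl : 0 < l) {w : EuclideanSpace ℝ (Fin d)} (hw : l * ‖w‖ ^ 2 < 2 * u * ⟪ν, w⟫) :
    x + l • w ∈ Ω ∧ |distB Ω (x + l • w) / l - ⟪ν, w⟫| ≤ l * (‖w‖ ^ 2 / (2 * u)) := by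
  have hne : (frontier Ω).Nonempty := ⟨x, hx⟩
  have hsub : ‖x + l • w - (x + u • ν)‖ ^ 2 = u ^ 2 + l * (l * ‖w‖ ^ 2 - 2 * u * ⟪ν, w⟫) := by
    rw [add_sub_add_left_eq_sub, norm_sub_sq_real, norm_smul, norm_smul, hν, inner_smul_left,
      inner_smul_right, real_inner_comm, Real.norm_eq_abs, Real.norm_eq_abs, mul_pow, sq_abs,
      mul_one, sq_abs]
    simp only [conj_trivial]
    ring
  have hadd : ‖x + l • w - (x - u • ν)‖ ^ 2 = u ^ 2 + l * (l * ‖w‖ ^ 2 + 2 * u * ⟪ν, w⟫) := by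
    rw [show x + l • w - (x - u • ν) = l • w + u • ν by abel, norm_add_sq_real, norm_smul,
      norm_smul, hν, inner_smul_left,
      inner_smul_right, real_inner_comm, Real.norm_eq_abs, Real.norm_eq_abs, mul_pow, sq_abs,
      mul_one, sq_abs]
    simp only [conj_trivial]
    ring
  have hmem : x + l • w ∈ Ω := by
    refine hin (mem_ball_iff_norm.2 (lt_of_pow_lt_pow_left₀ 2 hu.le ?_))
    rw [hsub]
    nlinarith
  have h1 := sub_norm_le_distB hne hΩ hin (x + l • w)
  have h2 := distB_le_norm_sub hne hΩ hu hout hmem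
  have h3 : ‖x + l • w - (x + u • ν)‖ ≤ u + l * (l * (‖w‖ ^ 2 / (2 * u)) - ⟪ν, w⟫) :=
    norm_le_of_norm_sq_le hu (le_of_eq (by rw [hsub]; field_simp))
  have h4 : ‖x + l • w - (x - u • ν)‖ ≤ u + l * (l * (‖w‖ ^ 2 / (2 * u)) + ⟪ν, w⟫) :=
    norm_le_of_norm_sq_le hu (le_of_eq (by rw [hadd]; field_simp))
  refine ⟨hmem, abs_le.2 ⟨?_, ?_⟩⟩
  · rw [le_sub_iff_add_le, le_div_iff₀ hl]
    linarith
  · rw [sub_le_iff_le_add, div_le_iff₀ hl]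
    linarith

lemma exists_bounds_of_isCompact {K : Set (EuclideanSpace ℝ (Fin d))} (hK : IsCompact K)
    (hKν : K ⊆ {w | 0 < ⟪ν, w⟫}) :
    ∃ m R : ℝ, 0 < m ∧ 0 < R ∧ ∀ w ∈ K, m ≤ ⟪ν, w⟫ ∧ ‖w‖ ≤ R := by
  obtain ⟨m, hm, hmK⟩ := hK.exists_forall_le' (f := fun w => ⟪ν, w⟫)
    (by fun_prop) fun w hw => hKν hw
  obtain ⟨R, hR, hRK⟩ := hK.isBounded.exists_pos_norm_le
  exact ⟨m, R, hm, hR, fun w hw => ⟨hmK w hw, hRK w hw⟩⟩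

lemma eventually_blowUp_bounds (hΩ : IsOpen Ω) (hx : x ∈ frontier Ω) (hu : 0 < u) (hν : ‖ν‖ = 1)
    (hin : ball (x + u • ν) u ⊆ Ω) (hout : Disjoint (ball (x - u • ν) u) Ω)
    {K : Set (EuclideanSpace ℝ (Fin d))} {m R : ℝ} (hm : 0 < m) (hR : 0 < R)
    (hK : ∀ w ∈ K, m ≤ ⟪ν, w⟫ ∧ ‖w‖ ≤ R) :
    ∀ᶠ l in 𝓝[>] (0 : ℝ), ∀ w ∈ K, x + l • w ∈ Ω ∧
      distB Ω (x + l • w) / l ∈ Icc (m / 2) R ∧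
      |distB Ω (x + l • w) / l - ⟪ν, w⟫| ≤ l * (R ^ 2 / (2 * u)) := by
  filter_upwards [Ioc_mem_nhdsGT (by positivity : 0 < u * m / R ^ 2)] with l hl w hw
  obtain ⟨h1, h2⟩ := hK w hw
  have hwR : ‖w‖ ^ 2 ≤ R ^ 2 := by gcongr
  have hlR : l * R ^ 2 ≤ u * m := (le_div_iff₀ (by positivity)).1 hl.2
  have hlw : l * ‖w‖ ^ 2 ≤ l * R ^ 2 := mul_le_mul_of_nonneg_left hwR hl.1.le
  have hum : u * m ≤ u * ⟪ν, w⟫ := mul_le_mul_of_nonneg_left h1 hu.le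
  have hum0 : 0 < u * m := by positivity
  obtain ⟨h3, h4⟩ := abs_distB_add_smul_sub_le hΩ hx hu hν hin hout hl.1
    (w := w) (by linarith)
  have h5 : l * (‖w‖ ^ 2 / (2 * u)) ≤ l * (R ^ 2 / (2 * u)) :=
    mul_le_mul_of_nonneg_left (by gcongr) hl.1.le
  have h6 : l * (R ^ 2 / (2 * u)) ≤ m / 2 := by
    rw [← mul_div_assoc, div_le_div_iff₀ (by positivity) two_pos]
    linarith
  refine ⟨h3, ⟨?_, ?_⟩, h4.trans h5⟩
  · linarith [(abs_le.1 h4).1]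
  · rw [div_le_iff₀ hl.1]
    refine (infDist_le_dist_of_mem hx).trans ?_
    rw [dist_self_add_left, norm_smul, Real.norm_eq_abs, abs_of_pos hl.1, mul_comm]
    gcongr
    exact hl.1.le

lemma tendsto_integral_blowUp (hΩ : IsOpen Ω) (hx : x ∈ frontier Ω) (hu : 0 < u) (hν : ‖ν‖ = 1)
    (hin : ball (x + u • ν) u ⊆ Ω) (hout : Disjoint (ball (x - u • ν) u) Ω) (p : ℝ)
    {F : EuclideanSpace ℝ (Fin d) → ℝ} (hF : Continuous F) (hFc : HasCompactSupport F)
    (hFs : tsupport F ⊆ {w | 0 < ⟪ν, w⟫}) :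
    Tendsto (fun l : ℝ => ∫ w, (distB Ω (x + l • w) / l) ^ p * F w) (𝓝[>] 0)
      (𝓝 (∫ w, ⟪ν, w⟫ ^ p * F w)) := by
  obtain ⟨m, R, hm, hR, hK⟩ := exists_bounds_of_isCompact hFc.isCompact hFs
  have hev := eventually_blowUp_bounds hΩ hx hu hν hin hout hm hR hK
  obtain ⟨B, hB⟩ := isCompact_Icc.exists_bound_of_continuousOn (f := fun t : ℝ => t ^ p)
    (s := Icc (m / 2) R) fun t ht => (Real.continuousAt_rpow_const _ _
      (Or.inl ((half_pos hm).trans_le ht.1).ne')).continuousWithinAt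
  refine tendsto_integral_filter_of_dominated_convergence (fun w => B * ‖F w‖) ?_ ?_
    ((hF.integrable_of_hasCompactSupport hFc).norm.const_mul B)
    (Eventually.of_forall fun w => ?_)
  · refine Eventually.of_forall fun l => AEStronglyMeasurable.mul ?_ hF.aestronglyMeasurable
    have : Continuous fun w => distB Ω (x + l • w) / l := by
      have := (lipschitzWith_distB (Ω := Ω)).continuous
      fun_prop
    exact (this.measurable.pow_const p).aestronglyMeasurable
  · filter_upwards [hev] with l hl
    refine Eventually.of_forall fun w => ?_
    by_cases hw : w ∈ tsupport F
    · rw [norm_mul]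
      exact mul_le_mul_of_nonneg_right (hB _ (hl w hw).2.1) (norm_nonneg _)
    · simp [image_eq_zero_of_notMem_tsupport hw]
  · by_cases hw : w ∈ tsupport F
    · refine Tendsto.mul_const _ (Tendsto.rpow_const ?_ (Or.inl (hFs hw).ne'))
      refine tendsto_iff_norm_sub_tendsto_zero.2 ?_
      have h0 : Tendsto (fun l : ℝ => l * (R ^ 2 / (2 * u))) (𝓝[>] 0) (𝓝 0) := by
        have : Continuous fun l : ℝ => l * (R ^ 2 / (2 * u)) := by fun_prop
        simpa using (this.tendsto 0).mono_left nhdsWithin_le_nhds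
      exact squeeze_zero' (Eventually.of_forall fun l => norm_nonneg _)
        (hev.mono fun l hl => (hl w hw).2.2) h0
    · simp [image_eq_zero_of_notMem_tsupport hw]

lemma integral_comp_add_smul {E : Type*} [NormedAddCommGroup E] [NormedSpace ℝ E]
    [MeasurableSpace E] [BorelSpace E] [FiniteDimensional ℝ E] (μ : Measure E) [μ.IsAddHaarMeasure]
    (F : E → ℝ) (x : E) (l : ℝ) :
    ∫ w, F (x + l • w) ∂μ = |(l ^ Module.finrank ℝ E)⁻¹| * ∫ y, F y ∂μ := by
  rw [Measure.integral_comp_smul μ (fun w => F (x + w)), integral_add_left_eq_self, smul_eq_mul]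

lemma hardy_halfSpace_of_bHardy (hΩ : IsOpen Ω) (hx : x ∈ frontier Ω) (hu : 0 < u) (hν : ‖ν‖ = 1)
    (hin : ball (x + u • ν) u ⊆ Ω) (hout : Disjoint (ball (x - u • ν) u) Ω)
    {V : Set (EuclideanSpace ℝ (Fin d))} (hV : IsOpen V) (hxV : x ∈ V) {δ r a : ℝ} (hr : 0 < r)
    (ha : 0 ≤ a) (H : BHardy Ω δ (bdryLayer Ω r ∩ V) a)
    {χ : EuclideanSpace ℝ (Fin d) → ℝ} (hχ : ContDiff ℝ 1 χ) (hχc : HasCompactSupport χ)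
    (hχs : tsupport χ ⊆ {w | 0 < ⟪ν, w⟫}) :
    ∫ w, ⟪ν, w⟫ ^ (δ - 2) * χ w ^ 2 ≤ a ^ 2 * ∫ w, ⟪ν, w⟫ ^ δ * ‖fderiv ℝ χ w‖ ^ 2 := by
  have hne : (frontier Ω).Nonempty := ⟨x, hx⟩
  rw [bHardy_iff hΩ hne ha fun y hy => hy.1.1] at H
  have hsq : tsupport (fun w => χ w ^ 2) ⊆ tsupport χ :=
    closure_mono fun y hy => by simpa using hy
  have hgs : tsupport (fun w => ‖fderiv ℝ χ w‖ ^ 2) ⊆ tsupport χ :=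
    (closure_mono fun y hy => by simpa using hy).trans (tsupport_norm_fderiv_subset χ)
  have lim1 := tendsto_integral_blowUp hΩ hx hu hν hin hout (δ - 2) (F := fun w => χ w ^ 2)
    (hχ.continuous.pow 2) (hχc.mono' (subset_closure.trans hsq)) (hsq.trans hχs)
  have lim2 := tendsto_integral_blowUp hΩ hx hu hν hin hout δ (F := fun w => ‖fderiv ℝ χ w‖ ^ 2)
    ((hχ.continuous_fderiv one_ne_zero).norm.pow 2) (hχc.mono' (subset_closure.trans hgs))
    (hgs.trans hχs)
  refine le_of_tendsto_of_tendsto lim1 (lim2.const_mul _) ?_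
  obtain ⟨m, R, hm, hR, hK⟩ := exists_bounds_of_isCompact hχc.isCompact hχs
  obtain ⟨ρ, hρ, hρV⟩ := Metric.isOpen_iff.1 hV x hxV
  filter_upwards [eventually_blowUp_bounds hΩ hx hu hν hin hout hm hR hK,
    Ioo_mem_nhdsGT (by positivity : 0 < min r ρ / R)] with l hl1 hl2
  have hl : 0 < l := hl2.1
  have hlR : l * R < min r ρ := (lt_div_iff₀ hR).1 hl2.2
  set e : EuclideanSpace ℝ (Fin d) ≃ₜ EuclideanSpace ℝ (Fin d) :=
    (Homeomorph.addLeft (-x)).trans (Homeomorph.smulOfNeZero l⁻¹ (inv_ne_zero hl.ne')) with he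
  have he' : ∀ y, e y = l⁻¹ • (-x + y) := fun y => rfl
  have hexl : ∀ w, e (x + l • w) = w := fun w => by
    rw [he', neg_add_cancel_left, inv_smul_smul₀ hl.ne']
  have hxe : ∀ y, x + l • e y = y := fun y => by
    rw [he', smul_inv_smul₀ hl.ne', add_neg_cancel_left]
  have hψs : tsupport (χ ∘ e) ⊆ bdryLayer Ω r ∩ V := by
    intro y hy
    rw [tsupport_comp_eq_preimage] at hy
    obtain ⟨h1, -, -⟩ := hl1 _ hy
    rw [hxe] at h1
    have h2 : dist y x < min r ρ := by
      rw [← hxe y, dist_self_add_left, norm_smul, Real.norm_eq_abs, abs_of_pos hl]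
      exact (mul_le_mul_of_nonneg_left (hK _ hy).2 hl.le).trans_lt hlR
    exact ⟨⟨h1, (infDist_le_dist_of_mem hx).trans_lt (h2.trans_le (min_le_left _ _))⟩,
      hρV (h2.trans_le (min_le_right _ _))⟩
  have hψC : ContDiff ℝ 1 (χ ∘ e) :=
    hχ.comp (contDiff_const_smul l⁻¹ |>.comp (contDiff_const.add contDiff_id))
  have hfd : ∀ w, fderiv ℝ (χ ∘ e) (x + l • w) = l⁻¹ • fderiv ℝ χ w := by
    intro w
    have h1 : HasFDerivAt e (l⁻¹ • ContinuousLinearMap.id ℝ _) (x + l • w) :=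
      ((hasFDerivAt_id _).const_add (-x)).const_smul l⁻¹
    have h2 : HasFDerivAt χ (fderiv ℝ χ w) (e (x + l • w)) := by
      rw [hexl]
      exact (hχ.differentiable one_ne_zero w).hasFDerivAt
    rw [(h2.comp _ h1).fderiv]
    ext v
    simp
  have hmain := mul_le_mul_of_nonneg_left
    (H (χ ∘ e) ⟨hψC, hχc.comp_homeomorph e, hψs⟩)
    (abs_nonneg (l ^ Module.finrank ℝ (EuclideanSpace ℝ (Fin d)))⁻¹)
  rw [mul_left_comm, ← integral_comp_add_smul volume _ x l,
    ← integral_comp_add_smul volume _ x l] at hmain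
  simp only [Function.comp_apply, hexl] at hmain
  have hD : ∀ w (p : ℝ), distB Ω (x + l • w) ^ p = l ^ p * (distB Ω (x + l • w) / l) ^ p := by
    intro w p
    have h0 : 0 ≤ distB Ω (x + l • w) := infDist_nonneg
    rw [← Real.mul_rpow hl.le (div_nonneg h0 hl.le), mul_div_cancel₀ _ hl.ne']
  have hfd2 : ∀ w, l ^ δ * ‖fderiv ℝ (χ ∘ e) (x + l • w)‖ ^ 2 =
      l ^ (δ - 2) * ‖fderiv ℝ χ w‖ ^ 2 := by
    intro w
    rw [hfd, norm_smul, norm_inv, Real.norm_eq_abs, abs_of_pos hl, Real.rpow_sub hl, Real.rpow_two]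
    field_simp
  have e1 : ∀ w, distB Ω (x + l • w) ^ (δ - 2) * χ w ^ 2 =
      l ^ (δ - 2) * ((distB Ω (x + l • w) / l) ^ (δ - 2) * χ w ^ 2) := fun w => by
    rw [hD, mul_assoc]
  have e2 : ∀ w, distB Ω (x + l • w) ^ δ * ‖fderiv ℝ (χ ∘ e) (x + l • w)‖ ^ 2 =
      l ^ (δ - 2) * ((distB Ω (x + l • w) / l) ^ δ * ‖fderiv ℝ χ w‖ ^ 2) := fun w => by
    rw [hD, mul_right_comm, hfd2]
    ring
  simp only [e1, e2] at hmain
  rw [integral_const_mul, integral_const_mul, mul_left_comm] at hmain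
  exact le_of_mul_le_mul_left hmain (Real.rpow_pos_of_pos hl _)

theorem two_div_le_of_bHardy (hΩ : IsOpen Ω) (hx : x ∈ frontier Ω) (hu : 0 < u)
    (hball : TwoSidedBall Ω u x) {V : Set (EuclideanSpace ℝ (Fin d))} (hV : IsOpen V)
    (hxV : x ∈ V) {δ r a : ℝ} (hδ : δ ≠ 1) (hr : 0 < r) (ha : 0 ≤ a)
    (H : BHardy Ω δ (bdryLayer Ω r ∩ V) a) : 2 / |δ - 1| ≤ a := by
  obtain ⟨ν, hν, hin, hout⟩ := hball.exists_normal hΩ hu hx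
  have hd : 0 < d := by
    rcases Nat.eq_zero_or_pos d with rfl | h
    · simp [Subsingleton.elim ν 0] at hν
    · exact h
  let i₀ : Fin d := ⟨0, hd⟩
  have horth : Orthonormal ℝ (({i₀} : Set (Fin d)).domRestrict fun _ => ν) := by
    rw [orthonormal_iff_ite]
    intro i j
    rw [if_pos (Subsingleton.elim i j)]
    simp [hν]
  obtain ⟨b, hb⟩ := horth.exists_orthonormalBasis_extension_of_card_eq (by simp)
  have hb₀ : b i₀ = ν := hb i₀ rfl
  refine two_div_le_of_hardy_line hδ ha fun f hf hfc hfs =>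
    hardy_line_of_hardy_halfSpace i₀ b (fun χ hχ hχc hχs => ?_) hf hfc hfs
  rw [hb₀] at hχs ⊢
  exact hardy_halfSpace_of_bHardy hΩ hx hu hν hin hout hV hxV hr ha H hχ hχc hχs

end BlowUp

/-- Let `x ∈ Γ` be a `C^{1,1}`-point, witnessed by a bounded open `U ∋ x`
and `u > 0` for which the two-sided ball condition with radius `u` holds at every point
of `Γ ∩ U` and every point of `Γ_u ∩ U` has its nearest boundary point in `Γ ∩ U`.
If `δ ≥ 0`, `δ ≠ 1`, then for every `r` with `0 < r < u/2` and `2(d-1)(r/u) < |δ-1|`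
the Hardy inequality holds on `Γ_r ∩ U` with constant `2/(|δ-1| - 2(d-1)(r/u))`;
moreover the local Hardy constant `a_δ(x)` equals `2/|δ-1|`. -/
theorem stmt10 {d : ℕ} (hd : 1 ≤ d) (Ω : Set (EuclideanSpace ℝ (Fin d)))
    (hΩ : IsDomainSet Ω)
    (x : EuclideanSpace ℝ (Fin d)) (hx : x ∈ frontier Ω)
    (U : Set (EuclideanSpace ℝ (Fin d))) (hUo : IsOpen U) (hUb : Bornology.IsBounded U)
    (hxU : x ∈ U) (u : ℝ) (hu : 0 < u)
    (hball : ∀ y ∈ frontier Ω ∩ U, TwoSidedBall Ω u y)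
    (hnear : ∀ y ∈ bdryLayer Ω u ∩ U, ∃ z ∈ frontier Ω ∩ U, dist y z = distB Ω y)
    (δ : ℝ) (hδ0 : 0 ≤ δ) (hδ1 : δ ≠ 1) :
    (∀ r : ℝ, 0 < r → r < u/2 → 2 * ((d : ℝ) - 1) * (r/u) < |δ - 1| →
      BHardy Ω δ (bdryLayer Ω r ∩ U) (2 / (|δ - 1| - 2 * ((d : ℝ) - 1) * (r/u)))) ∧
    (⨅ (V : Set (EuclideanSpace ℝ (Fin d)))
        (_ : IsOpen V ∧ Bornology.IsBounded V ∧ x ∈ V), hardyConstOn Ω δ V)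
      = ENNReal.ofReal (2 / |δ - 1|) := by
  have hΩo := hΩ.1
  have hne : (frontier Ω).Nonempty := ⟨x, hx⟩
  have hupper : ∀ r : ℝ, 0 < r → r < u/2 → 2 * ((d : ℝ) - 1) * (r/u) < |δ - 1| →
      BHardy Ω δ (bdryLayer Ω r ∩ U) (2 / (|δ - 1| - 2 * ((d : ℝ) - 1) * (r/u))) :=
    fun r _ hru hδr => bHardy_of_twoSidedBall hd hΩo hne hu hball hnear hru hδr
  have hδ : 0 < |δ - 1| := abs_pos.2 (sub_ne_zero.2 hδ1)
  refine ⟨hupper, le_antisymm ?_ ?_⟩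
  · have hlim0 : Tendsto (fun r : ℝ => 2 * ((d : ℝ) - 1) * (r/u)) (𝓝[>] 0) (𝓝 0) := by
      have : Continuous fun r : ℝ => 2 * ((d : ℝ) - 1) * (r/u) := by fun_prop
      simpa using (this.tendsto 0).mono_left nhdsWithin_le_nhds
    have hlim : Tendsto (fun r : ℝ =>
        ENNReal.ofReal (2 / (|δ - 1| - 2 * ((d : ℝ) - 1) * (r/u)))) (𝓝[>] 0)
        (𝓝 (ENNReal.ofReal (2 / |δ - 1|))) := by
      refine ENNReal.tendsto_ofReal (tendsto_const_nhds.div ?_ hδ.ne')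
      simpa using tendsto_const_nhds.sub hlim0
    refine ge_of_tendsto hlim ?_
    filter_upwards [hlim0.eventually_lt_const hδ, Ioo_mem_nhdsGT (half_pos hu)] with r h1 h2
    refine (iInf₂_le U ⟨hUo, hUb, hxU⟩).trans ((iInf₂_le r h2.1).trans (sInf_le ?_))
    exact ⟨_, div_pos two_pos (sub_pos.2 h1), rfl, hupper r h2.1 h2.2 h1⟩
  · refine le_iInf₂ fun V hV => le_iInf₂ fun r hr => le_sInf ?_
    rintro _ ⟨a, ha, rfl, H⟩
    exact ENNReal.ofReal_le_ofReal (two_div_le_of_bHardy hΩo hx hu (hball x ⟨hx, hxU⟩)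
      hV.1 hV.2.2 hδ1 hr ha.le H)
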